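/- arXiv:1105.3021 — 3 statements merged into one kernel-verified Lean document; each statement's English description precedes it below -/
import Mathlib

section
/- Let 1 ≤ p₁ ≤ p₂ ≤ 2 or 2 ≤ p₁ ≤ p₂ ≤ ∞. Then there exist constants c₂ ≥ c₁ > 0, depending only on p₁ and p₂, such that for every N ∈ ℕ and every k ∈ ℕ with 4k ≤ N one has c₁ ≤ a_k(id : ℓ_{p₁}^N → ℓ_{p₂}^N) ≤ c₂. -/
open scoped ENNReal

/-- The `k`-th approximation number of a continuous linear operator `T : X → Y`:
`a_k(T) = inf { ‖T - A‖ : A : X → Y bounded linear with rank A < k }`. -/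
noncomputable def approxNumber {X Y : Type*} [NormedAddCommGroup X] [NormedSpace ℂ X]
    [NormedAddCommGroup Y] [NormedSpace ℂ Y] (T : X →L[ℂ] Y) (k : ℕ) : ℝ :=
  sInf { r | ∃ A : X →L[ℂ] Y,
    Module.rank ℂ (LinearMap.range (A : X →ₗ[ℂ] Y)) < (k : Cardinal) ∧ r = ‖T - A‖ }

/-- The identity operator `id : ℓ_{p₁}^N → ℓ_{p₂}^N` on `ℂ^N`. -/
noncomputable def lpId (p₁ p₂ : ℝ≥0∞) [Fact (1 ≤ p₁)] [Fact (1 ≤ p₂)] (N : ℕ) :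
    PiLp p₁ (fun _ : Fin N => ℂ) →L[ℂ] PiLp p₂ (fun _ : Fin N => ℂ) :=
  LinearMap.toContinuousLinearMap
    (((WithLp.linearEquiv p₂ ℂ (Fin N → ℂ)).symm.toLinearMap).comp
      (WithLp.linearEquiv p₁ ℂ (Fin N → ℂ)).toLinearMap)

/-- The `ℓ_p` norms on a finite product decrease as the exponent increases. -/
theorem norm_toLp_le_of_exponent_le {ι : Type*} [Fintype ι] {p q : ℝ≥0∞} [Fact (1 ≤ p)]
    [Fact (1 ≤ q)] (hpq : p ≤ q) (x : ι → ℂ) :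
    ‖(WithLp.toLp q x : PiLp q (fun _ : ι => ℂ))‖ ≤
      ‖(WithLp.toLp p x : PiLp p (fun _ : ι => ℂ))‖ := by
  set M := ‖(WithLp.toLp p x : PiLp p (fun _ : ι => ℂ))‖ with hM
  have hM0 : 0 ≤ M := norm_nonneg _
  have hcoord (i : ι) : ‖x i‖ ≤ M := PiLp.norm_apply_le (WithLp.toLp p x) i
  rcases eq_or_ne q ∞ with rfl | hq
  · rw [PiLp.norm_eq_ciSup]
    exact Real.iSup_le hcoord hM0
  have hp : p ≠ ∞ := ne_top_of_le_ne_top hq hpq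
  have hp0 : 0 < p.toReal := p.toReal_pos_iff_ne_top.mpr hp
  have hq0 : 0 < q.toReal := q.toReal_pos_iff_ne_top.mpr hq
  have hpq' : p.toReal ≤ q.toReal := ENNReal.toReal_mono hq hpq
  have hsum : ∑ i, ‖x i‖ ^ p.toReal = M ^ p.toReal := by
    rw [hM, PiLp.norm_eq_sum hp0, ← Real.rpow_mul (by positivity), one_div,
      inv_mul_cancel₀ hp0.ne', Real.rpow_one]
  have hsplit {t : ℝ} (ht : 0 ≤ t) :
      t ^ q.toReal = t ^ (q.toReal - p.toReal) * t ^ p.toReal := by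
    rw [← Real.rpow_add_of_nonneg ht (sub_nonneg.2 hpq') hp0.le, sub_add_cancel]
  rw [PiLp.norm_eq_sum hq0, one_div, Real.rpow_inv_le_iff_of_pos (by positivity) hM0 hq0,
    hsplit hM0, ← hsum, Finset.mul_sum]
  refine Finset.sum_le_sum fun i _ => ?_
  rw [hsplit (norm_nonneg _)]
  have := Real.rpow_le_rpow (norm_nonneg _) (hcoord i) (sub_nonneg.2 hpq')
  gcongr

theorem trace_starProjection {E : Type*} [NormedAddCommGroup E] [InnerProductSpace ℂ E]
    [FiniteDimensional ℂ E] (K : Submodule ℂ E) :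
    LinearMap.trace ℂ E (K.starProjection : E →ₗ[ℂ] E) = Module.finrank ℂ K := by
  refine LinearMap.IsProj.trace (p := K) ⟨fun x => ?_, fun x hx => ?_⟩
  · exact K.starProjection_apply_mem x
  · exact Submodule.starProjection_eq_self_iff.2 hx

/-- The dimension of a subspace is bounded through the diagonal of its orthogonal projection. -/
theorem finrank_le_card_mul_of_diagonal_le {ι : Type*} [Fintype ι] [DecidableEq ι]
    (K : Submodule ℂ (EuclideanSpace ℂ ι)) {c : ℝ}
    (hc : ∀ i, ‖K.starProjection (EuclideanSpace.single i 1) i‖ ≤ c) :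
    (Module.finrank ℂ K : ℝ) ≤ Fintype.card ι * c := by
  have htr := trace_starProjection K
  rw [LinearMap.trace_eq_sum_inner _ (EuclideanSpace.basisFun ι ℂ)] at htr
  calc (Module.finrank ℂ K : ℝ) = ‖(Module.finrank ℂ K : ℂ)‖ := by simp
    _ ≤ ∑ i : ι, c := by
      rw [← htr]
      refine norm_sum_le_of_le _ fun i _ => ?_
      simpa [EuclideanSpace.inner_single_left] using hc i
    _ = Fintype.card ι * c := by simp

/-- If `I - A` maps `ℓ_2` to `ℓ_∞` with norm at most `c`, then the nullity of `A` is at most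
`c` times the dimension. -/
theorem finrank_ker_le_of_norm_coord_le {ι : Type*} [Fintype ι] [DecidableEq ι]
    (A : EuclideanSpace ℂ ι →ₗ[ℂ] EuclideanSpace ℂ ι) {c : ℝ} (hc0 : 0 ≤ c)
    (hc : ∀ x i, ‖(x - A x) i‖ ≤ c * ‖x‖) :
    (Module.finrank ℂ (LinearMap.ker A) : ℝ) ≤ Fintype.card ι * c := by
  refine finrank_le_card_mul_of_diagonal_le _ fun i => ?_
  set y := (LinearMap.ker A).starProjection (EuclideanSpace.single i 1)
  have hy : A y = 0 := (LinearMap.ker A).starProjection_apply_mem _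
  have hn : ‖y‖ ≤ 1 := by
    simpa using (LinearMap.ker A).norm_starProjection_apply_le (EuclideanSpace.single i 1)
  have := hc y i
  rw [hy, sub_zero] at this
  nlinarith

/-- If `I - A` maps `ℓ_1` to `ℓ_2` with norm at most `c`, then the corank of `A` is at most
`c` times the dimension. -/
theorem finrank_range_orthogonal_le_of_norm_column_le {ι : Type*} [Fintype ι] [DecidableEq ι]
    (A : EuclideanSpace ℂ ι →ₗ[ℂ] EuclideanSpace ℂ ι) {c : ℝ}
    (hc : ∀ i, ‖EuclideanSpace.single i 1 - A (EuclideanSpace.single i 1)‖ ≤ c) :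
    (Module.finrank ℂ (LinearMap.range A)ᗮ : ℝ) ≤ Fintype.card ι * c := by
  refine finrank_le_card_mul_of_diagonal_le _ fun i => ?_
  set K := (LinearMap.range A)ᗮ
  set e : EuclideanSpace ℂ ι := EuclideanSpace.single i 1
  have hA : K.starProjection (A e) = 0 :=
    Submodule.starProjection_orthogonal_apply_eq_zero (LinearMap.mem_range_self A e)
  calc ‖K.starProjection e i‖ ≤ ‖K.starProjection e‖ := PiLp.norm_apply_le _ i
    _ = ‖K.starProjection (e - A e)‖ := by rw [map_sub, hA, sub_zero]
    _ ≤ ‖e - A e‖ := K.norm_starProjection_apply_le _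
    _ ≤ c := hc i

theorem approxNumber_le_norm {X Y : Type*} [NormedAddCommGroup X] [NormedSpace ℂ X]
    [NormedAddCommGroup Y] [NormedSpace ℂ Y] (T : X →L[ℂ] Y) {k : ℕ} (hk : 1 ≤ k) :
    approxNumber T k ≤ ‖T‖ := by
  refine csInf_le ⟨0, ?_⟩ ⟨0, ?_, by simp⟩
  · rintro r ⟨A, -, rfl⟩
    exact norm_nonneg _
  · simpa [LinearMap.range_zero] using Nat.pos_of_ne_zero (by omega)

theorem norm_lpId_le_one {p₁ p₂ : ℝ≥0∞} [Fact (1 ≤ p₁)] [Fact (1 ≤ p₂)] (h : p₁ ≤ p₂) (N : ℕ) :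
    ‖lpId p₁ p₂ N‖ ≤ 1 :=
  ContinuousLinearMap.opNorm_le_bound _ zero_le_one fun x => by
    rw [one_mul]
    exact norm_toLp_le_of_exponent_le h x.ofLp

/-- The operator on Euclidean space with the same matrix as an operator between
`ℓ_{p₁}^N` and `ℓ_{p₂}^N`. -/
noncomputable def toEuclideanEnd {p₁ p₂ : ℝ≥0∞} [Fact (1 ≤ p₁)] [Fact (1 ≤ p₂)] {N : ℕ}
    (A : PiLp p₁ (fun _ : Fin N => ℂ) →L[ℂ] PiLp p₂ (fun _ : Fin N => ℂ)) :
    EuclideanSpace ℂ (Fin N) →ₗ[ℂ] EuclideanSpace ℂ (Fin N) :=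
  (lpId p₂ 2 N).toLinearMap ∘ₗ A.toLinearMap ∘ₗ (lpId 2 p₁ N).toLinearMap

theorem finrank_range_toEuclideanEnd_lt {p₁ p₂ : ℝ≥0∞} [Fact (1 ≤ p₁)] [Fact (1 ≤ p₂)] {N k : ℕ}
    {A : PiLp p₁ (fun _ : Fin N => ℂ) →L[ℂ] PiLp p₂ (fun _ : Fin N => ℂ)}
    (hA : Module.rank ℂ (LinearMap.range A.toLinearMap) <
      (k : Cardinal)) :
    Module.finrank ℂ (LinearMap.range (toEuclideanEnd A)) < k := by
  refine Module.finrank_lt_of_rank_lt (lt_of_le_of_lt ?_ hA)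
  exact (LinearMap.rank_comp_le_right _ _).trans (LinearMap.rank_comp_le_left _ _)

theorem three_quarters_le_norm_lpId_sub {p₁ p₂ : ℝ≥0∞} [Fact (1 ≤ p₁)] [Fact (1 ≤ p₂)]
    (h : p₂ ≤ 2 ∨ 2 ≤ p₁) {N k : ℕ} (hkN : 4 * k ≤ N)
    {A : PiLp p₁ (fun _ : Fin N => ℂ) →L[ℂ] PiLp p₂ (fun _ : Fin N => ℂ)}
    (hA : Module.rank ℂ (LinearMap.range A.toLinearMap) <
      (k : Cardinal)) :
    3 / 4 ≤ ‖lpId p₁ p₂ N - A‖ := by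
  set c := ‖lpId p₁ p₂ N - A‖
  set M := toEuclideanEnd A
  have hr : Module.finrank ℂ (LinearMap.range M) < k := finrank_range_toEuclideanEnd_lt hA
  suffices hs : ((N - Module.finrank ℂ (LinearMap.range M) : ℝ)) ≤ N * c by
    have h1 : (Module.finrank ℂ (LinearMap.range M) : ℝ) < k := by exact_mod_cast hr
    have h2 : 4 * (k : ℝ) ≤ N := by exact_mod_cast hkN
    have h3 : (0 : ℝ) < N := by
      have : 0 < N := by omega
      exact_mod_cast this
    nlinarith
  rcases h with h | h
  · have hdim : (Module.finrank ℂ (LinearMap.range M) +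
        Module.finrank ℂ (LinearMap.range M)ᗮ : ℝ) = N := by
      exact_mod_cast (LinearMap.range M).finrank_add_finrank_orthogonal.trans (by simp)
    have := finrank_range_orthogonal_le_of_norm_column_le M (c := c) fun i => by
      have h1 := (lpId p₁ p₂ N - A).le_opNorm (PiLp.single p₁ i 1)
      rw [PiLp.norm_single, norm_one, mul_one] at h1
      exact (norm_toLp_le_of_exponent_le h
        ((lpId p₁ p₂ N - A) (PiLp.single p₁ i 1)).ofLp).trans h1
    rw [Fintype.card_fin] at this
    linarith
  · have hdim : (Module.finrank ℂ (LinearMap.range M) +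
        Module.finrank ℂ (LinearMap.ker M) : ℝ) = N := by
      exact_mod_cast M.finrank_range_add_finrank_ker.trans (by simp)
    have := finrank_ker_le_of_norm_coord_le M (c := c) (norm_nonneg _) fun x i => by
      have h1 := (lpId p₁ p₂ N - A).le_opNorm (WithLp.toLp p₁ x.ofLp)
      refine (PiLp.norm_apply_le ((lpId p₁ p₂ N - A) (WithLp.toLp p₁ x.ofLp)) i).trans
        (h1.trans ?_)
      exact mul_le_mul_of_nonneg_left (norm_toLp_le_of_exponent_le h x.ofLp) (norm_nonneg _)
    rw [Fintype.card_fin] at this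
    linarith

/-- If `1 ≤ p₁ ≤ p₂ ≤ 2` or `2 ≤ p₁ ≤ p₂ ≤ ∞`, then `a_k(id : ℓ_{p₁}^N → ℓ_{p₂}^N) ∼ 1`
for `4k ≤ N`, with equivalence constants depending only on `p₁, p₂`. -/
theorem stmt0 (p₁ p₂ : ℝ≥0∞) [Fact (1 ≤ p₁)] [Fact (1 ≤ p₂)]
    (h : (p₁ ≤ p₂ ∧ p₂ ≤ 2) ∨ (2 ≤ p₁ ∧ p₁ ≤ p₂)) :
    ∃ c₁ c₂ : ℝ, 0 < c₁ ∧ c₁ ≤ c₂ ∧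
      ∀ N k : ℕ, 1 ≤ k → 4 * k ≤ N →
        c₁ ≤ approxNumber (lpId p₁ p₂ N) k ∧ approxNumber (lpId p₁ p₂ N) k ≤ c₂ := by
  refine ⟨3 / 4, 1, by norm_num, by norm_num, fun N k hk hkN => ⟨?_, ?_⟩⟩
  · refine le_csInf ⟨_, 0, ?_, rfl⟩ ?_
    · simpa [LinearMap.range_zero] using Nat.pos_of_ne_zero (by omega)
    · rintro r ⟨A, hA, rfl⟩
      exact three_quarters_le_norm_lpId_sub (h.imp And.right And.left) hkN hA
  · exact (approxNumber_le_norm _ hk).trans (norm_lpId_le_one (h.elim And.left And.right) N)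
end

section
/- Let 1 ≤ p₁ < 2 < p₂ ≤ ∞ with (p₁, p₂) ≠ (1, ∞), and set t = min(p₁′, p₂). Then there exist constants c₂ ≥ c₁ > 0, depending only on p₁ and p₂, such that for every N ∈ ℕ and every k ∈ ℕ with 4k ≤ N one has c₁ · min(1, N^{1/t} k^{−1/2}) ≤ a_k(id : ℓ_{p₁}^N → ℓ_{p₂}^N) ≤ c₂ · min(1, N^{1/t} k^{−1/2}). -/
open scoped ENNReal

/-- The conjugate exponent `p′` of `p ∈ [1, ∞]`, characterized by `1/p + 1/p′ = 1`. -/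
noncomputable def conjExp (p : ℝ≥0∞) : ℝ≥0∞ := (1 - p⁻¹)⁻¹

/-- The sign `±1` encoded by a Boolean. -/
def boolSign (b : Bool) : ℝ := if b then 1 else -1

lemma boolSign_not (b : Bool) : boolSign (!b) = -boolSign b := by cases b <;> simp [boolSign]

lemma boolSign_sq (b : Bool) : boolSign b ^ 2 = 1 := by cases b <;> simp [boolSign]

lemma boolSign_mul_self (b : Bool) : boolSign b * boolSign b = 1 := by cases b <;> simp [boolSign]

section RandomSigns

variable {ι : Type*} [DecidableEq ι]

/-- Flipping one coordinate of a family of signs. -/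
def flipAt (j : ι) (σ : ι → Bool) : ι → Bool := Function.update σ j (!σ j)

lemma flipAt_same (j : ι) (σ : ι → Bool) : flipAt j σ j = !σ j := by simp [flipAt]

lemma flipAt_ne {i j : ι} (h : i ≠ j) (σ : ι → Bool) : flipAt j σ i = σ i := by
  simp [flipAt, h]

lemma flipAt_involutive (j : ι) : Function.Involutive (flipAt j) := by
  intro σ
  ext i
  by_cases h : i = j
  · subst h; simp [flipAt]
  · simp [flipAt, h]

lemma sum_boolSign_flipAt {j : ι} {s : Finset ι} (hj : j ∉ s) (a : ι → ℝ) (σ : ι → Bool) :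
    ∑ i ∈ s, boolSign (flipAt j σ i) * a i = ∑ i ∈ s, boolSign (σ i) * a i :=
  Finset.sum_congr rfl fun i hi => by rw [flipAt_ne (by rintro rfl; exact hj hi)]

variable [Fintype ι]

lemma sum_flipAt (j : ι) (f : (ι → Bool) → ℝ) : ∑ σ, f (flipAt j σ) = ∑ σ, f σ :=
  Equiv.sum_comp (flipAt_involutive j).toPerm f

lemma sum_le_sum_of_flipAt (j : ι) {f g : (ι → Bool) → ℝ}
    (h : ∀ σ, f σ + f (flipAt j σ) ≤ 2 * g σ) : ∑ σ, f σ ≤ ∑ σ, g σ := by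
  have h1 := Finset.sum_le_sum fun σ (_ : σ ∈ Finset.univ) => h σ
  rw [Finset.sum_add_distrib, sum_flipAt, ← Finset.mul_sum] at h1
  linarith

lemma exp_add_exp_neg_le (c b : ℝ) :
    Real.exp (c + b) + Real.exp (c - b) ≤ 2 * Real.exp (c + b ^ 2 / 2) := by
  have h := Real.cosh_le_exp_half_sq b
  rw [Real.cosh_eq] at h
  rw [sub_eq_add_neg, Real.exp_add, Real.exp_add, Real.exp_add]
  nlinarith [Real.exp_pos c]

/-- Exponential square integrability of Rademacher sums. -/
lemma sum_exp_sq_le (a : ι → ℝ) (ha : ∀ i, a i ^ 2 ≤ 1) (s : Finset ι) :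
    ∀ d : ℝ, 2 * (s.card : ℝ) < d →
      ∑ σ : ι → Bool, Real.exp ((∑ i ∈ s, boolSign (σ i) * a i) ^ 2 / d) ≤
        Fintype.card (ι → Bool) * Real.exp (s.card / (d - 2 * s.card)) := by
  induction s using Finset.induction_on with
  | empty => intro d _; simp
  | insert j s hj ih =>
    intro d hd
    rw [Finset.card_insert_of_notMem hj] at hd ⊢
    push_cast at hd ⊢
    have hs : (0 : ℝ) ≤ s.card := Nat.cast_nonneg _
    have hd2 : 0 < d - 2 := by linarith
    have hd0 : 0 < d := by linarith
    calc ∑ σ : ι → Bool, Real.exp ((∑ i ∈ insert j s, boolSign (σ i) * a i) ^ 2 / d)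
        ≤ ∑ σ : ι → Bool, Real.exp (1 / d) *
            Real.exp ((∑ i ∈ s, boolSign (σ i) * a i) ^ 2 / (d - 2)) := by
          refine sum_le_sum_of_flipAt j fun σ => ?_
          rw [Finset.sum_insert hj, Finset.sum_insert hj, sum_boolSign_flipAt hj, flipAt_same,
            boolSign_not]
          set y := ∑ i ∈ s, boolSign (σ i) * a i
          have h1 := exp_add_exp_neg_le (y ^ 2 / d + a j ^ 2 / d)
            (2 * boolSign (σ j) * a j * y / d)
          have hb := boolSign_sq (σ j)
          have e1 : (boolSign (σ j) * a j + y) ^ 2 / d =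
              (y ^ 2 / d + a j ^ 2 / d) + 2 * boolSign (σ j) * a j * y / d := by
            rw [← add_div, ← add_div]; congr 1
            linear_combination a j ^ 2 * hb
          have e2 : (-boolSign (σ j) * a j + y) ^ 2 / d =
              (y ^ 2 / d + a j ^ 2 / d) - 2 * boolSign (σ j) * a j * y / d := by
            rw [← add_div, ← sub_div]; congr 1
            linear_combination a j ^ 2 * hb
          rw [e1, e2]
          refine h1.trans ?_
          rw [← Real.exp_add]
          refine mul_le_mul_of_nonneg_left (Real.exp_le_exp.2 ?_) zero_le_two
          have e3 : (2 * boolSign (σ j) * a j * y / d) ^ 2 / 2 = 2 * a j ^ 2 * y ^ 2 / d ^ 2 := by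
            rw [div_pow, mul_pow, mul_pow, mul_pow, hb]; ring
          rw [e3]
          have e4 : a j ^ 2 / d ≤ 1 / d := by gcongr; exact ha j
          have e5 : 2 * a j ^ 2 * y ^ 2 / d ^ 2 ≤ 2 * 1 * y ^ 2 / d ^ 2 := by
            gcongr; exact ha j
          have e6 : y ^ 2 / d + 2 * 1 * y ^ 2 / d ^ 2 ≤ y ^ 2 / (d - 2) := by
            rw [div_add_div _ _ hd0.ne' (by positivity), div_le_div_iff₀ (by positivity) hd2]
            nlinarith [mul_nonneg hd0.le (sq_nonneg y)]
          linarith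
      _ ≤ Real.exp (1 / d) * (Fintype.card (ι → Bool) *
            Real.exp (s.card / (d - 2 - 2 * s.card))) := by
          rw [← Finset.mul_sum]
          gcongr
          exact ih _ (by linarith)
      _ = Fintype.card (ι → Bool) * Real.exp (1 / d + s.card / (d - 2 - 2 * s.card)) := by
          rw [Real.exp_add]; ring
      _ ≤ _ := by
          gcongr
          have e : d - 2 - 2 * (s.card : ℝ) = d - 2 * (s.card + 1) := by ring
          rw [e, add_div, add_comm]
          gcongr
          linarith

/-- The exponential supermartingale bound for a Rademacher sum multiplied by a quantity that
does not depend on the signs involved. -/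
lemma sum_exp_mul_sub_le (a : ι → ℝ) (ha : ∀ i, a i ^ 2 ≤ 1) (s : Finset ι)
    (f : (ι → Bool) → ℝ) (hf : ∀ j ∈ s, ∀ σ, f (flipAt j σ) = f σ) :
    ∑ σ : ι → Bool, Real.exp ((∑ i ∈ s, boolSign (σ i) * a i) * f σ - s.card * f σ ^ 2 / 2) ≤
      Fintype.card (ι → Bool) := by
  induction s using Finset.induction_on with
  | empty => simp
  | insert j s hj ih =>
    refine le_trans (sum_le_sum_of_flipAt j fun σ => ?_)
      (ih fun i hi => hf i (Finset.mem_insert_of_mem hi))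
    rw [hf j (Finset.mem_insert_self _ _), Finset.sum_insert hj, Finset.sum_insert hj,
      sum_boolSign_flipAt hj, flipAt_same, boolSign_not, Finset.card_insert_of_notMem hj]
    push_cast
    set y := ∑ i ∈ s, boolSign (σ i) * a i
    have h1 := exp_add_exp_neg_le (y * f σ - (s.card + 1) * f σ ^ 2 / 2)
      (boolSign (σ j) * a j * f σ)
    have hb := boolSign_sq (σ j)
    have e1 : (boolSign (σ j) * a j + y) * f σ - (s.card + 1) * f σ ^ 2 / 2 =
      y * f σ - (s.card + 1) * f σ ^ 2 / 2 + boolSign (σ j) * a j * f σ := by ring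
    have e2 : (-boolSign (σ j) * a j + y) * f σ - (s.card + 1) * f σ ^ 2 / 2 =
      y * f σ - (s.card + 1) * f σ ^ 2 / 2 - boolSign (σ j) * a j * f σ := by ring
    rw [e1, e2]
    refine h1.trans ?_
    gcongr
    rw [mul_pow, mul_pow, hb]
    nlinarith [mul_le_mul_of_nonneg_right (ha j) (sq_nonneg (f σ))]

end RandomSigns

section SignMatrix

variable {ι : Type*} [Fintype ι]

/-- The support of a sign pattern. -/
def patSupp (ε : ι → SignType) : Finset ι := Finset.univ.filter fun i => ε i ≠ 0

/-- The inner product of a vector of signs with a sign pattern. -/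
def patDot (σ : ι → Bool) (ε : ι → SignType) : ℝ := ∑ i, boolSign (σ i) * (ε i : ℝ)

lemma patDot_eq (σ : ι → Bool) (ε : ι → SignType) :
    patDot σ ε = ∑ i ∈ patSupp ε, boolSign (σ i) * (ε i : ℝ) := by
  rw [patDot, patSupp, Finset.sum_filter]
  refine Finset.sum_congr rfl fun i _ => ?_
  split_ifs with h
  · rfl
  · rw [not_not] at h; simp [h]

lemma patSupp_card_pos {ε : ι → SignType} (h : ε ≠ 0) : 0 < (patSupp ε).card := by
  obtain ⟨i, hi⟩ := Function.ne_iff.1 h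
  exact Finset.card_pos.2 ⟨i, by simpa [patSupp] using hi⟩

lemma signType_cast_sq_le (e : SignType) : (e : ℝ) ^ 2 ≤ 1 := by cases e <;> simp

lemma sum_exp_sum_eq {α : Type*} [Fintype α] (κ : ℕ) (h : α → ℝ) :
    ∑ ω : Fin κ → α, Real.exp (∑ i, h (ω i)) = (∑ a, Real.exp (h a)) ^ κ := by
  rw [Fintype.sum_pow]
  exact Finset.sum_congr rfl fun ω _ => Real.exp_sum _ _

variable [DecidableEq ι]

/-- A sign matrix `G` whose action on all sign patterns, and whose Gram form on disjoint sign
patterns, is controlled. -/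
lemma exists_signMatrix (κ : ℕ) (ℓ : ℕ → ℝ) (θ : ℕ → ℕ → ℝ) (hθ : ∀ s r, 0 < s → 0 < r → 0 < θ s r)
    (hsum : ∑ ε : ι → SignType with ε ≠ 0, Real.exp (-ℓ (patSupp ε).card) ≤ 1 / 3) :
    ∃ G : Fin κ → ι → Bool,
      (∀ ε : ι → SignType, ε ≠ 0 → ∑ i, patDot (G i) ε ^ 2 ≤
        4 * (patSupp ε).card * (κ / 2 + ℓ (patSupp ε).card)) ∧
      (∀ ε ε' : ι → SignType, ε ≠ 0 → ε' ≠ 0 → Disjoint (patSupp ε) (patSupp ε') →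
        ∑ i, patDot (G i) ε * patDot (G i) ε' ≤
          θ (patSupp ε).card (patSupp ε').card * (patSupp ε).card *
            (∑ i, patDot (G i) ε' ^ 2) / 2 +
          (ℓ (patSupp ε).card + ℓ (patSupp ε').card) /
            θ (patSupp ε).card (patSupp ε').card) := by
  classical
  set M : ℝ := ((Fintype.card (ι → Bool) : ℕ) : ℝ) with hM
  have hMpos : 0 < M := by rw [hM]; exact_mod_cast Fintype.card_pos
  let P : Finset (ι → SignType) := Finset.univ.filter fun ε => ε ≠ 0
  let D : Finset ((ι → SignType) × (ι → SignType)) :=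
    (P ×ˢ P).filter fun p => Disjoint (patSupp p.1) (patSupp p.2)
  let n : (ι → SignType) → ℕ := fun ε => (patSupp ε).card
  let f₁ : (ι → SignType) → (ι → Bool) → ℝ := fun ε σ => patDot σ ε ^ 2 / (4 * n ε)
  let f₂ : (ι → SignType) × (ι → SignType) → (ι → Bool) → ℝ := fun p σ =>
    patDot σ p.1 * (θ (n p.1) (n p.2) * patDot σ p.2) -
      n p.1 * (θ (n p.1) (n p.2) * patDot σ p.2) ^ 2 / 2
  let Z : (Fin κ → ι → Bool) → ℝ := fun ω =>
    ∑ ε ∈ P, Real.exp (∑ i, f₁ ε (ω i)) * Real.exp (-(κ / 2 + ℓ (n ε))) +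
      ∑ p ∈ D, Real.exp (∑ i, f₂ p (ω i)) * Real.exp (-(ℓ (n p.1) + ℓ (n p.2)))
  have b₁ : ∀ ε ∈ P, ∑ ω : Fin κ → ι → Bool, Real.exp (∑ i, f₁ ε (ω i)) ≤
      M ^ κ * Real.exp (κ / 2) := by
    intro ε hε
    have hpos : 0 < n ε := patSupp_card_pos (by simpa [P] using hε)
    have hpos' : (0 : ℝ) < n ε := by exact_mod_cast hpos
    rw [sum_exp_sum_eq]
    have h := sum_exp_sq_le (fun i => (ε i : ℝ)) (fun i => signType_cast_sq_le _) (patSupp ε)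
      (4 * n ε) (by change 2 * (n ε : ℝ) < _; linarith)
    have e : ((patSupp ε).card : ℝ) / (4 * n ε - 2 * (patSupp ε).card) = 1 / 2 := by
      change (n ε : ℝ) / (4 * n ε - 2 * n ε) = _
      field_simp; norm_num
    rw [e] at h
    have h2 : ∑ σ, Real.exp (f₁ ε σ) ≤ M * Real.exp (1 / 2) := by
      simpa only [f₁, patDot_eq] using h
    calc _ ≤ (M * Real.exp (1 / 2)) ^ κ := by
          gcongr
      _ = _ := by rw [mul_pow, ← Real.exp_nat_mul]; ring_nf
  have b₂ : ∀ p ∈ D, ∑ ω : Fin κ → ι → Bool, Real.exp (∑ i, f₂ p (ω i)) ≤ M ^ κ := by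
    intro p hp
    have hdis : Disjoint (patSupp p.1) (patSupp p.2) := (Finset.mem_filter.1 hp).2
    rw [sum_exp_sum_eq]
    have h := sum_exp_mul_sub_le (fun i => (p.1 i : ℝ)) (fun i => signType_cast_sq_le _)
      (patSupp p.1) (fun σ => θ (n p.1) (n p.2) * patDot σ p.2) (fun j hj σ => by
        simp only [patDot_eq]
        rw [sum_boolSign_flipAt (Finset.disjoint_left.1 hdis hj)])
    gcongr
    refine le_trans (le_of_eq ?_) h
    refine Finset.sum_congr rfl fun σ _ => ?_
    simp only [f₂]
    rw [patDot_eq σ p.1]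
  have hZ : ∑ ω, Z ω ≤ M ^ κ * (4 / 9) := by
    simp only [Z]
    rw [Finset.sum_add_distrib, Finset.sum_comm, Finset.sum_comm (t := D)]
    have h1 : ∑ ε ∈ P, ∑ ω : Fin κ → ι → Bool, Real.exp (∑ i, f₁ ε (ω i)) *
        Real.exp (-(κ / 2 + ℓ (n ε))) ≤ ∑ ε ∈ P, M ^ κ * Real.exp (-ℓ (n ε)) := by
      refine Finset.sum_le_sum fun ε hε => ?_
      rw [← Finset.sum_mul]
      refine (mul_le_mul_of_nonneg_right (b₁ ε hε) (Real.exp_pos _).le).trans (le_of_eq ?_)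
      rw [mul_assoc, ← Real.exp_add]; ring_nf
    have h2 : ∑ p ∈ D, ∑ ω : Fin κ → ι → Bool, Real.exp (∑ i, f₂ p (ω i)) *
        Real.exp (-(ℓ (n p.1) + ℓ (n p.2))) ≤
        ∑ p ∈ P ×ˢ P, M ^ κ * (Real.exp (-ℓ (n p.1)) * Real.exp (-ℓ (n p.2))) := by
      refine le_trans (Finset.sum_le_sum fun p hp => ?_)
        (Finset.sum_le_sum_of_subset_of_nonneg (Finset.filter_subset _ _) fun _ _ _ => by positivity)
      rw [← Finset.sum_mul, ← Real.exp_add, ← neg_add]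
      exact mul_le_mul_of_nonneg_right (b₂ p hp) (Real.exp_pos _).le
    rw [← Finset.mul_sum] at h1 h2
    rw [Finset.sum_product] at h2
    dsimp only at h2
    rw [← Finset.sum_mul_sum] at h2
    have h0 : 0 ≤ ∑ ε ∈ P, Real.exp (-ℓ (n ε)) := by positivity
    have h3 : (∑ ε ∈ P, Real.exp (-ℓ (n ε))) * (∑ ε ∈ P, Real.exp (-ℓ (n ε))) ≤
        1 / 3 * (1 / 3) := by gcongr
    have h4 : 0 < M ^ κ := by positivity
    have h5 : M ^ κ * (∑ ε ∈ P, Real.exp (-ℓ (n ε))) ≤ M ^ κ * (1 / 3) := by gcongr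
    have h6 := mul_le_mul_of_nonneg_left h3 h4.le
    linarith
  obtain ⟨G, hG⟩ : ∃ G, Z G < 1 := by
    by_contra! hcon
    have h := Finset.sum_le_sum fun ω (_ : ω ∈ Finset.univ) => hcon ω
    rw [Finset.sum_const, Finset.card_univ, Fintype.card_fun, Fintype.card_fin] at h
    have h4 : 0 < M ^ κ := by positivity
    simp only [nsmul_eq_mul, mul_one] at h
    push_cast at h
    linarith [h.trans hZ]
  have hsplit : (∀ ε ∈ P, ∑ i, f₁ ε (G i) ≤ κ / 2 + ℓ (n ε)) ∧
      ∀ p ∈ D, ∑ i, f₂ p (G i) ≤ ℓ (n p.1) + ℓ (n p.2) := by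
    have n1 : 0 ≤ ∑ ε ∈ P, Real.exp (∑ i, f₁ ε (G i)) * Real.exp (-(κ / 2 + ℓ (n ε))) := by
      positivity
    have n2 : 0 ≤ ∑ p ∈ D, Real.exp (∑ i, f₂ p (G i)) * Real.exp (-(ℓ (n p.1) + ℓ (n p.2))) := by
      positivity
    have key : ∀ a b : ℝ, Real.exp a * Real.exp (-b) ≤ 1 → a ≤ b := fun a b h => by
      rw [← Real.exp_add, Real.exp_le_one_iff] at h; linarith
    constructor
    · intro ε hε
      refine key _ _ ((Finset.single_le_sum (f := fun ε => Real.exp (∑ i, f₁ ε (G i)) *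
        Real.exp (-(κ / 2 + ℓ (n ε)))) (fun _ _ => by positivity) hε).trans ?_)
      simp only [Z] at hG
      linarith
    · intro p hp
      refine key _ _ ((Finset.single_le_sum (f := fun p => Real.exp (∑ i, f₂ p (G i)) *
        Real.exp (-(ℓ (n p.1) + ℓ (n p.2)))) (fun _ _ => by positivity) hp).trans ?_)
      simp only [Z] at hG
      linarith
  refine ⟨G, fun ε hε => ?_, fun ε ε' hε hε' hd => ?_⟩
  · have h := hsplit.1 ε (by simpa [P] using hε)
    have hpos' : (0 : ℝ) < n ε := by exact_mod_cast patSupp_card_pos hε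
    simp only [f₁] at h
    rw [← Finset.sum_div, div_le_iff₀ (by positivity)] at h
    change _ ≤ 4 * (n ε : ℝ) * (κ / 2 + ℓ (n ε))
    linarith
  · have h := hsplit.2 (ε, ε') (by simp [D, P, hε, hε', hd])
    have hp := hθ _ _ (patSupp_card_pos hε) (patSupp_card_pos hε')
    simp only [f₂, n] at h
    set T := θ (patSupp ε).card (patSupp ε').card
    have e : ∑ i, (patDot (G i) ε * (T * patDot (G i) ε') -
        (patSupp ε).card * (T * patDot (G i) ε') ^ 2 / 2) =
        T * ((∑ i, patDot (G i) ε * patDot (G i) ε') -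
          T * (patSupp ε).card * (∑ i, patDot (G i) ε' ^ 2) / 2) := by
      simp only [mul_sub, Finset.sum_sub_distrib, Finset.mul_sum, Finset.sum_div]
      congr 1
      · exact Finset.sum_congr rfl fun i _ => by ring
      · exact Finset.sum_congr rfl fun i _ => by ring
    rw [e, ← le_div_iff₀' hp] at h
    linarith

end SignMatrix

section Counting

variable {ι : Type*} [Fintype ι]

lemma sum_pow_patSupp_card [DecidableEq ι] (z : ℝ) :
    ∑ ε : ι → SignType, z ^ (patSupp ε).card = (1 + 2 * z) ^ Fintype.card ι := by
  have h : ∀ ε : ι → SignType, z ^ (patSupp ε).card = ∏ i, if ε i ≠ 0 then z else 1 := by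
    intro ε
    rw [Finset.prod_ite, Finset.prod_const, Finset.prod_const_one, mul_one, patSupp]
  simp_rw [h]
  have h2 := Finset.prod_univ_sum (fun _ : ι => (Finset.univ : Finset SignType))
    (fun _ e => if e ≠ 0 then z else 1)
  rw [Fintype.piFinset_univ] at h2
  rw [← h2, Finset.prod_const, Finset.card_univ]
  congr 1
  have : (Finset.univ : Finset SignType) = {0, -1, 1} := rfl
  rw [this]
  simp
  ring

lemma card_patSupp_eq_le [DecidableEq ι] {s : ℕ} (hs : 0 < s) (hN : 0 < Fintype.card ι) :
    ((Finset.univ.filter fun ε : ι → SignType => (patSupp ε).card = s).card : ℝ) ≤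
      (Real.exp 2 * (Fintype.card ι / s)) ^ s := by
  set N := Fintype.card ι
  have hs' : (0 : ℝ) < s := by exact_mod_cast hs
  have hN' : (0 : ℝ) < N := by exact_mod_cast hN
  set z : ℝ := s / N with hz
  have hzp : 0 < z := by positivity
  have h1 : ((Finset.univ.filter fun ε : ι → SignType => (patSupp ε).card = s).card : ℝ) * z ^ s
      ≤ (1 + 2 * z) ^ N := by
    rw [← sum_pow_patSupp_card, ← nsmul_eq_mul, ← Finset.sum_const]
    refine le_trans (le_of_eq ?_) (Finset.sum_le_sum_of_subset_of_nonneg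
      (Finset.filter_subset (fun ε : ι → SignType => (patSupp ε).card = s) _)
      fun _ _ _ => by positivity)
    exact Finset.sum_congr rfl fun ε hε => by rw [(Finset.mem_filter.1 hε).2]
  have h2 : (1 + 2 * z) ^ N ≤ Real.exp 2 ^ s := by
    calc (1 + 2 * z) ^ N ≤ Real.exp (2 * z) ^ N := by
          gcongr
          linarith [Real.add_one_le_exp (2 * z)]
      _ = Real.exp 2 ^ s := by
          rw [← Real.exp_nat_mul, ← Real.exp_nat_mul, hz]
          congr 1; field_simp
  have h3 : (N / s : ℝ) = z⁻¹ := by rw [hz, inv_div]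
  rw [h3, mul_pow, inv_pow, ← div_eq_mul_inv, le_div_iff₀ (by positivity)]
  exact h1.trans h2

lemma sum_exp_neg_le_third [DecidableEq ι] (ℓ : ℕ → ℝ)
    (hℓ : ∀ s : ℕ, 0 < s → s ≤ Fintype.card ι →
      s * Real.log (4 * Real.exp 2 * (Fintype.card ι / s)) ≤ ℓ s) :
    ∑ ε : ι → SignType with ε ≠ 0, Real.exp (-ℓ (patSupp ε).card) ≤ 1 / 3 := by
  classical
  set N := Fintype.card ι with hNdef
  have hmap : ∀ ε ∈ Finset.univ.filter (fun ε : ι → SignType => ε ≠ 0),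
      (patSupp ε).card ∈ Finset.Ico 1 (N + 1) := by
    intro ε hε
    have h1 := patSupp_card_pos (Finset.mem_filter.1 hε).2
    have h2 := Finset.card_le_univ (patSupp ε)
    rw [Finset.mem_Ico]; omega
  rw [← Finset.sum_fiberwise_of_maps_to hmap]
  have hterm : ∀ s ∈ Finset.Ico 1 (N + 1), ∑ ε ∈ (Finset.univ.filter
      (fun ε : ι → SignType => ε ≠ 0)) with (patSupp ε).card = s,
        Real.exp (-ℓ (patSupp ε).card) ≤ (1 / 4 : ℝ) ^ s := by
    intro s hs
    rw [Finset.mem_Ico] at hs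
    have hs0 : 0 < s := by omega
    have hN0 : 0 < N := by omega
    have hs' : (0 : ℝ) < s := by exact_mod_cast hs0
    have hN' : (0 : ℝ) < N := by exact_mod_cast hN0
    have hb : Real.exp (-ℓ s) ≤ (4 * Real.exp 2 * (N / s))⁻¹ ^ s := by
      have h := hℓ s hs0 (by omega)
      rw [← Real.log_pow] at h
      rw [inv_pow, Real.exp_neg]
      gcongr
      exact (Real.log_le_iff_le_exp (by positivity)).1 h
    calc _ ≤ ∑ ε : ι → SignType with (patSupp ε).card = s, Real.exp (-ℓ (patSupp ε).card) := by
          refine Finset.sum_le_sum_of_subset_of_nonneg ?_ fun _ _ _ => by positivity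
          intro ε hε
          simp only [Finset.mem_filter, Finset.mem_univ, true_and] at hε ⊢
          exact hε.2
      _ = ((Finset.univ.filter fun ε : ι → SignType => (patSupp ε).card = s).card : ℝ) *
            Real.exp (-ℓ s) := by
          rw [← nsmul_eq_mul, ← Finset.sum_const]
          exact Finset.sum_congr rfl fun ε hε => by rw [(Finset.mem_filter.1 hε).2]
      _ ≤ (Real.exp 2 * (N / s)) ^ s * (4 * Real.exp 2 * (N / s))⁻¹ ^ s := by
          gcongr
          exact card_patSupp_eq_le hs0 hN0
      _ = (1 / 4 : ℝ) ^ s := by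
          rw [← mul_pow]; congr 1
          have := Real.exp_pos 2
          field_simp
  refine (Finset.sum_le_sum hterm).trans ?_
  rw [geom_sum_Ico (by norm_num) (by omega)]
  have : (0 : ℝ) < (1 / 4) ^ (N + 1) := by positivity
  rw [div_le_iff_of_neg (by norm_num)]
  linarith

end Counting

section Gram

/-- The growth function controlling the Gram form of a random sign matrix on sign patterns. -/
noncomputable def patGauge (N : ℕ) (α : ℝ) (s : ℕ) : ℝ :=
  √(Real.log (4 * Real.exp 2) + 1 / α) * ((N : ℝ) ^ (α / 2) * (s : ℝ) ^ (1 - α / 2))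

lemma patGauge_nonneg (N : ℕ) (α : ℝ) (s : ℕ) : 0 ≤ patGauge N α s := by
  unfold patGauge; positivity

lemma log_four_mul_exp_two_nonneg : 0 ≤ Real.log (4 * Real.exp 2) :=
  Real.log_nonneg (by nlinarith [Real.add_one_le_exp (2 : ℝ)])

lemma le_of_optimal_parameter {a b s r κ T X Y : ℝ} (ha : 0 < a) (hb : 0 ≤ b) (hba : b ≤ a)
    (hs : 0 < s) (hr : 0 < r) (hκ : 0 < κ) (hT : 0 < T)
    (hT2 : T ^ 2 = (a + b) / (2 * s * r * (κ / 2 + b))) (hY : Y ≤ 4 * r * (κ / 2 + b))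
    (hX : X ≤ T * s * Y / 2 + (a + b) / T) :
    X ≤ 4 * (√κ * (√a * √s * √r) + √a * √s * (√b * √r)) := by
  have hV : 0 < κ / 2 + b := by positivity
  have hT3 : T ^ 2 * (2 * s * r * (κ / 2 + b)) = a + b := by rw [hT2]; field_simp
  have h5 : X ≤ 2 * ((a + b) / T) := by
    have h : T * s * Y / 2 ≤ T * s * (4 * r * (κ / 2 + b)) / 2 := by gcongr
    have e : T * s * (4 * r * (κ / 2 + b)) / 2 = (a + b) / T := by
      rw [eq_div_iff hT.ne']; linear_combination hT3
    linarith
  have h6 : (a + b) / T = √((a + b) * (2 * s * r * (κ / 2 + b))) := by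
    symm
    rw [Real.sqrt_eq_iff_mul_self_eq (by positivity) (by positivity), div_mul_div_comm,
      eq_div_iff (by positivity)]
    linear_combination (a + b) * hT3
  have h7 : √((a + b) * (2 * s * r * (κ / 2 + b))) ≤ √(4 * (a * s * (r * κ) + a * s * (b * r))) := by
    apply Real.sqrt_le_sqrt
    calc (a + b) * (2 * s * r * (κ / 2 + b)) ≤ (a + a) * (2 * s * r * (κ + b)) := by
          have : κ / 2 + b ≤ κ + b := by linarith
          gcongr
      _ = _ := by ring
  have h8 : √(4 * (a * s * (r * κ) + a * s * (b * r))) ≤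
      2 * (√κ * (√a * √s * √r) + √a * √s * (√b * √r)) := by
    rw [Real.sqrt_le_left (by positivity)]
    have hx : 0 ≤ √κ * (√a * √s * √r) := by positivity
    have hy : 0 ≤ √a * √s * (√b * √r) := by positivity
    have ex : (√κ * (√a * √s * √r)) ^ 2 = a * s * (r * κ) := by
      simp only [mul_pow]
      rw [Real.sq_sqrt hκ.le, Real.sq_sqrt ha.le, Real.sq_sqrt hs.le, Real.sq_sqrt hr.le]; ring
    have ey : (√a * √s * (√b * √r)) ^ 2 = a * s * (b * r) := by
      simp only [mul_pow]
      rw [Real.sq_sqrt hb, Real.sq_sqrt ha.le, Real.sq_sqrt hs.le, Real.sq_sqrt hr.le]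
    nlinarith [mul_nonneg hx hy]
  linarith

variable {ι : Type*} [Fintype ι] [DecidableEq ι]

lemma exists_signMatrix_gram_le {κ : ℕ} (hκ : 0 < κ) {α : ℝ} (hα : 0 < α) (hα1 : α < 1) :
    ∃ G : Fin κ → ι → Bool, ∀ ε ε' : ι → SignType, Disjoint (patSupp ε) (patSupp ε') →
      ∑ i, patDot (G i) ε * patDot (G i) ε' ≤
        4 * (√κ * (patGauge (Fintype.card ι) α (patSupp ε).card * √(patSupp ε').card +
          patGauge (Fintype.card ι) α (patSupp ε').card * √(patSupp ε).card) +
          patGauge (Fintype.card ι) α (patSupp ε).card *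
            patGauge (Fintype.card ι) α (patSupp ε').card) := by
  set N := Fintype.card ι with hN
  set c := Real.log (4 * Real.exp 2) + 1 / α with hc
  have hc0 : 0 < c := by have := log_four_mul_exp_two_nonneg; positivity
  set ℓ : ℕ → ℝ := fun s => c * ((N : ℝ) ^ α * (s : ℝ) ^ (1 - α)) with hℓ
  have hℓ0 : ∀ s, 0 ≤ ℓ s := fun s => by simp only [hℓ]; positivity
  have hκ' : (0 : ℝ) < κ := by exact_mod_cast hκ
  set θ : ℕ → ℕ → ℝ := fun s r =>
    if 0 < ℓ s + ℓ r then √((ℓ s + ℓ r) / (2 * s * r * (κ / 2 + ℓ r))) else 1 with hθ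
  have hθ0 : ∀ s r, 0 < s → 0 < r → 0 < θ s r := by
    intro s r hs hr
    simp only [hθ]
    split_ifs with h
    · have := hℓ0 r
      positivity
    · exact one_pos
  have hsum := sum_exp_neg_le_third (ι := ι) ℓ (fun s hs hsN => by
    have hs' : (0 : ℝ) < s := by exact_mod_cast hs
    have hN' : (0 : ℝ) < N := by exact_mod_cast lt_of_lt_of_le hs hsN
    have hu : (1 : ℝ) ≤ N / s := by
      rw [le_div_iff₀ hs', one_mul]; exact_mod_cast hsN
    have h1 : Real.log (N / s) ≤ (N / s : ℝ) ^ α / α := Real.log_le_rpow_div (by positivity) hα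
    have h2 : (1 : ℝ) ≤ (N / s : ℝ) ^ α := Real.one_le_rpow hu hα.le
    have h3 : Real.log (4 * Real.exp 2 * (N / s)) ≤ c * (N / s : ℝ) ^ α := by
      rw [Real.log_mul (by positivity) (by positivity), hc, add_mul]
      have := mul_le_mul_of_nonneg_left h2 log_four_mul_exp_two_nonneg
      have e : 1 / α * (N / s : ℝ) ^ α = (N / s : ℝ) ^ α / α := by ring
      rw [e]; linarith
    have h4 : ℓ s = s * (c * (N / s : ℝ) ^ α) := by
      simp only [hℓ]
      rw [Real.div_rpow hN'.le hs'.le, Real.rpow_sub hs', Real.rpow_one]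
      field_simp
    rw [h4]; gcongr)
  obtain ⟨G, h1, h2⟩ := exists_signMatrix κ ℓ θ hθ0 hsum
  have hg : ∀ s : ℕ, 0 < s → patGauge N α s = √(ℓ s) * √s := by
    intro s hs
    have hs' : (0 : ℝ) < s := by exact_mod_cast hs
    simp only [hℓ, patGauge]
    rw [Real.sqrt_mul hc0.le, Real.sqrt_mul (by positivity), mul_assoc, mul_assoc]
    congr 2
    · rw [Real.sqrt_eq_rpow, ← Real.rpow_mul (by positivity)]; ring_nf
    · rw [Real.sqrt_eq_rpow, Real.sqrt_eq_rpow, ← Real.rpow_mul (by positivity),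
        ← Real.rpow_add hs']
      ring_nf
  have key : ∀ ε ε' : ι → SignType, Disjoint (patSupp ε) (patSupp ε') → ε ≠ 0 → ε' ≠ 0 →
      (patSupp ε').card ≤ (patSupp ε).card →
      ∑ i, patDot (G i) ε * patDot (G i) ε' ≤
        4 * (√κ * (patGauge N α (patSupp ε).card * √(patSupp ε').card) +
          patGauge N α (patSupp ε).card * patGauge N α (patSupp ε').card) := by
    intro ε ε' hd hε hε' hle
    have h3 := h1 ε' hε'
    have h4 := h2 ε ε' hε hε' hd
    have hs := patSupp_card_pos hε
    have hr := patSupp_card_pos hε'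
    set s := (patSupp ε).card
    set r := (patSupp ε').card
    have hs' : (0 : ℝ) < s := by exact_mod_cast hs
    have hr' : (0 : ℝ) < r := by exact_mod_cast hr
    have hsN : s ≤ N := Finset.card_le_univ _
    have hN' : (0 : ℝ) < N := by exact_mod_cast lt_of_lt_of_le hs hsN
    have hℓs : 0 < ℓ s := by simp only [hℓ]; positivity
    have hℓr := hℓ0 r
    have hmono : ℓ r ≤ ℓ s := by
      simp only [hℓ]
      gcongr
    have hθp := hθ0 s r hs hr
    set T := θ s r with hT
    have hT2 : T ^ 2 = (ℓ s + ℓ r) / (2 * s * r * (κ / 2 + ℓ r)) := by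
      rw [hT]; simp only [hθ]
      rw [if_pos (by linarith), Real.sq_sqrt (by positivity)]
    rw [hg s hs, hg r hr]
    exact le_of_optimal_parameter hℓs hℓr hmono hs' hr' hκ' hθp hT2 h3 h4
  refine ⟨G, fun ε ε' hd => ?_⟩
  have p1 := patGauge_nonneg N α (patSupp ε).card
  have p2 := patGauge_nonneg N α (patSupp ε').card
  have q1 := mul_nonneg (Real.sqrt_nonneg κ) (mul_nonneg p1 (Real.sqrt_nonneg (patSupp ε').card))
  have q2 := mul_nonneg (Real.sqrt_nonneg κ) (mul_nonneg p2 (Real.sqrt_nonneg (patSupp ε).card))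
  have q3 := mul_nonneg p1 p2
  by_cases hε : ε = 0
  · have : ∑ i, patDot (G i) ε * patDot (G i) ε' = 0 := by simp [patDot, hε]
    rw [this]; linarith
  by_cases hε' : ε' = 0
  · have : ∑ i, patDot (G i) ε * patDot (G i) ε' = 0 := by simp [patDot, hε']
    rw [this]; linarith
  rcases le_total (patSupp ε').card (patSupp ε).card with h | h
  · linarith [key ε ε' hd hε hε' h]
  · have h3 := key ε' ε hd.symm hε' hε h
    simp_rw [mul_comm (patDot _ ε') (patDot _ ε)] at h3
    linarith

end Gram

section LayerCake

open MeasureTheory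

/-- The sign pattern of the entries of `x` exceeding the level `τ` in modulus. -/
noncomputable def levelPattern {ι : Type*} (x : ι → ℝ) (τ : ℝ) (j : ι) : SignType :=
  if τ < |x j| then SignType.sign (x j) else 0

lemma levelPattern_cast {ι : Type*} (x : ι → ℝ) (τ : ℝ) (j : ι) :
    (levelPattern x τ j : ℝ) =
      (Set.Iio |x j|).indicator (fun _ => ((SignType.sign (x j) : SignType) : ℝ)) τ := by
  unfold levelPattern Set.indicator
  by_cases h : τ < |x j| <;> simp [h]

lemma integrableOn_levelPattern {ι : Type*} (x : ι → ℝ) (j : ι) :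
    IntegrableOn (fun τ => (levelPattern x τ j : ℝ)) (Set.Ioc 0 1) := by
  simp_rw [levelPattern_cast]
  exact (integrable_const _).indicator measurableSet_Iio

lemma setIntegral_levelPattern {ι : Type*} (x : ι → ℝ) (j : ι) (hx : |x j| ≤ 1) :
    ∫ τ in Set.Ioc (0 : ℝ) 1, (levelPattern x τ j : ℝ) = x j := by
  simp_rw [levelPattern_cast]
  rw [setIntegral_indicator measurableSet_Iio, setIntegral_const]
  have : Set.Ioc (0 : ℝ) 1 ∩ Set.Iio |x j| = Set.Ioo 0 |x j| := by
    ext τ; simp only [Set.mem_inter_iff, Set.mem_Ioc, Set.mem_Iio, Set.mem_Ioo]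
    constructor
    · rintro ⟨⟨h1, _⟩, h2⟩; exact ⟨h1, h2⟩
    · rintro ⟨h1, h2⟩; exact ⟨⟨h1, by linarith⟩, h2⟩
  rw [this, Real.volume_real_Ioo_of_le (abs_nonneg _), smul_eq_mul, sub_zero, abs_mul_sign]

variable {ι : Type*} [Fintype ι]

lemma sum_mul_le_setIntegral (c x : ι → ℝ) (hx : ∀ j, |x j| ≤ 1) {g : ℝ → ℝ}
    (hg : IntegrableOn g (Set.Ioc 0 1))
    (h : ∀ τ ∈ Set.Ioc (0 : ℝ) 1, ∑ j, c j * (levelPattern x τ j : ℝ) ≤ g τ) :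
    ∑ j, c j * x j ≤ ∫ τ in Set.Ioc (0 : ℝ) 1, g τ := by
  have e : ∑ j, c j * x j =
      ∫ τ in Set.Ioc (0 : ℝ) 1, ∑ j, c j * (levelPattern x τ j : ℝ) := by
    rw [integral_finsetSum _ fun j _ => (integrableOn_levelPattern x j).const_mul (c j)]
    refine Finset.sum_congr rfl fun j _ => ?_
    rw [integral_const_mul, setIntegral_levelPattern x j (hx j)]
  rw [e]
  exact setIntegral_mono_on
    (integrable_finsetSum _ fun j _ => (integrableOn_levelPattern x j).const_mul (c j)) hg
    measurableSet_Ioc h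

lemma abs_le_one_of_sum_rpow_le {x : ι → ℝ} {u : ℝ} (hu : 0 < u) (hx : ∑ j, |x j| ^ u ≤ 1) (j : ι) :
    |x j| ≤ 1 := by
  have h := (Finset.single_le_sum (f := fun j => |x j| ^ u) (fun _ _ => by positivity)
    (Finset.mem_univ j)).trans hx
  by_contra! hcon
  exact absurd h (not_le.2 (Real.one_lt_rpow hcon hu))

lemma card_patSupp_levelPattern_le {x : ι → ℝ} {u : ℝ} (hu : 0 < u) (hx : ∑ j, |x j| ^ u ≤ 1)
    {τ : ℝ} (hτ : 0 < τ) : ((patSupp (levelPattern x τ)).card : ℝ) ≤ τ ^ (-u) := by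
  rw [Real.rpow_neg hτ.le, ← one_div, le_div_iff₀ (by positivity), ← nsmul_eq_mul,
    ← Finset.sum_const]
  refine le_trans ?_ hx
  refine le_trans (Finset.sum_le_sum fun j hj => ?_)
    (Finset.sum_le_sum_of_subset_of_nonneg (Finset.subset_univ _) fun _ _ _ => by positivity)
  have : τ < |x j| := by
    by_contra hcon
    simp [patSupp, levelPattern, hcon] at hj
  gcongr

lemma patSupp_levelPattern_subset (x : ι → ℝ) {τ : ℝ} {j : ι}
    (hj : j ∈ patSupp (levelPattern x τ)) : x j ≠ 0 := by
  intro h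
  simp [patSupp, levelPattern, h] at hj

lemma integrableOn_rpow_neg {r : ℝ} (hr : r < 1) :
    IntegrableOn (fun τ : ℝ => τ ^ (-r)) (Set.Ioc 0 1) := by
  rw [← intervalIntegrable_iff_integrableOn_Ioc_of_le zero_le_one]
  exact intervalIntegral.intervalIntegrable_rpow' (by linarith)

lemma setIntegral_rpow_neg {r : ℝ} (hr : r < 1) :
    ∫ τ in Set.Ioc (0 : ℝ) 1, τ ^ (-r) = 1 / (1 - r) := by
  rw [← intervalIntegral.integral_of_le zero_le_one, integral_rpow (Or.inl (by linarith)),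
    Real.one_rpow, Real.zero_rpow (by linarith)]
  ring_nf

lemma integrableOn_add_rpow_neg {δ r : ℝ} (hδ : 0 < δ) :
    IntegrableOn (fun τ : ℝ => (δ + τ) ^ (-r)) (Set.Ioc 0 1) := by
  rw [← intervalIntegrable_iff_integrableOn_Ioc_of_le zero_le_one]
  refine ContinuousOn.intervalIntegrable fun τ hτ => ?_
  rw [Set.uIcc_of_le zero_le_one] at hτ
  refine ContinuousAt.continuousWithinAt ?_
  have : δ + τ ≠ 0 := by have := hτ.1; positivity
  fun_prop (disch := simp [this])

lemma setIntegral_add_rpow_neg_le {δ r : ℝ} (hδ : 0 < δ) (hr : 1 < r) :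
    ∫ τ in Set.Ioc (0 : ℝ) 1, (δ + τ) ^ (-r) ≤ δ ^ (1 - r) / (r - 1) := by
  rw [← intervalIntegral.integral_of_le zero_le_one,
    intervalIntegral.integral_comp_add_left (fun τ => τ ^ (-r)) δ,
    integral_rpow (Or.inr ⟨by linarith, by
      rw [Set.uIcc_of_le (by linarith)]; intro h; linarith [h.1]⟩)]
  have h1 : 0 ≤ (δ + 1) ^ (1 - r) := by positivity
  have e : -r + 1 = 1 - r := by ring
  rw [e, add_zero, ← neg_sub r 1, div_neg, ← neg_div, neg_sub]
  rw [neg_sub]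
  gcongr
  · linarith

/-- Random sign matrices have a controlled Gram form on disjointly supported vectors of the unit
ball of `ℓ_u`, where `u` is the conjugate exponent of `t`. -/
lemma exists_signMatrix_disjoint_le {t u : ℝ} (ht : 2 < t) (htu : 1 / t + 1 / u = 1) (hu : 0 < u) :
    ∃ C : ℝ, 0 < C ∧ ∀ (N κ : ℕ), 0 < κ → (N : ℝ) ^ (1 / t) ≤ 2 * √κ →
      ∃ G : Fin κ → Fin N → Bool, ∀ x y : Fin N → ℝ,
        ∑ j, |x j| ^ u ≤ 1 → ∑ j, |y j| ^ u ≤ 1 → (∀ j, x j = 0 ∨ y j = 0) →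
        ∑ i, (∑ j, boolSign (G i j) * x j) * (∑ j, boolSign (G i j) * y j) ≤
          C * (√κ * (N : ℝ) ^ (1 / t)) := by
  have ht0 : 0 < t := by linarith
  have hut : u * (t - 1) = t := by field_simp at htu; linarith
  have hu2 : u < 2 := by nlinarith
  have hu1 : 1 < u := by nlinarith
  set α := 1 / t with hα
  have hα0 : 0 < α := by positivity
  have hα1 : α < 1 := by rw [hα, div_lt_one ht0]; linarith
  set a := 1 - α / 2 with ha
  have ha0 : 0 < a := by rw [ha]; linarith
  have hau : 1 < u * a := by
    have : u * a = u - u * α / 2 := by rw [ha]; ring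
    have h2 : u * α = u - 1 := by
      rw [hα]; field_simp; linarith
    rw [this, h2]; linarith
  have hαu : α = 1 - 1 / u := by linarith
  set q := 1 / (1 - u / 2) with hq
  have hq0 : 0 < q := by rw [hq]; apply one_div_pos.2; linarith
  set c := √(Real.log (4 * Real.exp 2) + 1 / α) with hc
  have hc0 : 0 < c := by
    have := log_four_mul_exp_two_nonneg
    rw [hc]; positivity
  set K := c * 4 / (u * a - 1) with hK
  have hK0 : 0 < K := by rw [hK]; apply div_pos; positivity; linarith
  refine ⟨4 * (2 * K * q + 2 * K ^ 2), by positivity, fun N κ hκ hNκ => ?_⟩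
  rcases Nat.eq_zero_or_pos N with rfl | hN
  · exact ⟨fun _ _ => true, fun x y _ _ _ => by simp; positivity⟩
  have hN' : (0 : ℝ) < N := by exact_mod_cast hN
  obtain ⟨G, hG⟩ := exists_signMatrix_gram_le (ι := Fin N) hκ hα0 hα1
  rw [Fintype.card_fin] at hG
  refine ⟨G, fun x y hx hy hxy => ?_⟩
  set δ := (N : ℝ) ^ (-(1 / u)) with hδ
  have hδ0 : 0 < δ := by positivity
  let P : ℝ → ℝ := fun τ => c * (N : ℝ) ^ (α / 2) * 4 * (δ + τ) ^ (-(u * a))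
  let Q : ℝ → ℝ := fun τ => τ ^ (-(u / 2))
  have hPint : IntegrableOn P (Set.Ioc 0 1) := (integrableOn_add_rpow_neg hδ0).const_mul _
  have hQint : IntegrableOn Q (Set.Ioc 0 1) := integrableOn_rpow_neg (by linarith)
  have hQ : ∫ τ in Set.Ioc (0 : ℝ) 1, Q τ = q := setIntegral_rpow_neg (by linarith)
  have hP : ∫ τ in Set.Ioc (0 : ℝ) 1, P τ ≤ K * (N : ℝ) ^ α := by
    simp only [P]
    rw [integral_const_mul]
    refine (mul_le_mul_of_nonneg_left (setIntegral_add_rpow_neg_le hδ0 hau)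
      (by positivity)).trans (le_of_eq ?_)
    have e : δ ^ (1 - u * a) = (N : ℝ) ^ (α / 2) := by
      rw [hδ, ← Real.rpow_mul hN'.le]
      congr 1
      have : u * a = u - u * α / 2 := by rw [ha]; ring
      rw [this, hαu]; field_simp; ring
    rw [e, hK]
    have : (N : ℝ) ^ α = (N : ℝ) ^ (α / 2) * (N : ℝ) ^ (α / 2) := by
      rw [← Real.rpow_add hN']; ring_nf
    rw [this]; ring
  have hP0 : ∀ τ ∈ Set.Ioc (0 : ℝ) 1, 0 ≤ P τ := fun τ hτ => by
    have := hτ.1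
    simp only [P]; positivity
  have hQ0 : ∀ τ ∈ Set.Ioc (0 : ℝ) 1, 0 ≤ Q τ := fun τ hτ => by
    have := hτ.1
    simp only [Q]; positivity
  have gQ : ∀ z : Fin N → ℝ, ∑ j, |z j| ^ u ≤ 1 → ∀ τ ∈ Set.Ioc (0 : ℝ) 1,
      √((patSupp (levelPattern z τ)).card : ℝ) ≤ Q τ := by
    intro z hz τ hτ
    rw [Real.sqrt_eq_rpow]
    calc _ ≤ (τ ^ (-u)) ^ (1 / 2 : ℝ) := by
          gcongr
          exact card_patSupp_levelPattern_le hu hz hτ.1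
      _ = Q τ := by
          simp only [Q]
          rw [← Real.rpow_mul hτ.1.le]; ring_nf
  have gP : ∀ z : Fin N → ℝ, ∑ j, |z j| ^ u ≤ 1 → ∀ τ ∈ Set.Ioc (0 : ℝ) 1,
      patGauge N α (patSupp (levelPattern z τ)).card ≤ P τ := by
    intro z hz τ hτ
    have hτ0 := hτ.1
    have h1 : ((patSupp (levelPattern z τ)).card : ℝ) ≤ ((δ + τ) / 2) ^ (-u) := by
      rcases le_total δ τ with h | h
      · refine (card_patSupp_levelPattern_le hu hz hτ.1).trans ?_
        exact Real.rpow_le_rpow_of_nonpos (by positivity) (by linarith) (by linarith)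
      · have h2 : ((patSupp (levelPattern z τ)).card : ℝ) ≤ N := by
          exact_mod_cast (Finset.card_le_univ _).trans (by simp)
        have h3 : (N : ℝ) = δ ^ (-u) := by
          rw [hδ, ← Real.rpow_mul hN'.le]
          have : -(1 / u) * -u = 1 := by field_simp
          rw [this, Real.rpow_one]
        rw [h3] at h2
        refine h2.trans ?_
        exact Real.rpow_le_rpow_of_nonpos (by positivity) (by linarith) (by linarith)
    have h4 : ((patSupp (levelPattern z τ)).card : ℝ) ^ a ≤ 4 * (δ + τ) ^ (-(u * a)) := by
      calc _ ≤ (((δ + τ) / 2) ^ (-u)) ^ a := by gcongr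
        _ = (2 : ℝ) ^ (u * a) * (δ + τ) ^ (-(u * a)) := by
          rw [← Real.rpow_mul (by positivity), Real.div_rpow (by positivity) (by positivity),
            neg_mul, Real.rpow_neg zero_le_two (u * a), div_inv_eq_mul, mul_comm]
        _ ≤ (2 : ℝ) ^ (2 : ℝ) * (δ + τ) ^ (-(u * a)) := by
          gcongr
          · norm_num
          · have : a ≤ 1 := by rw [ha]; linarith
            nlinarith
        _ = _ := by norm_num
    unfold patGauge
    rw [← hc, ← ha]
    simp only [P]
    calc _ ≤ c * ((N : ℝ) ^ (α / 2) * (4 * (δ + τ) ^ (-(u * a)))) := by gcongr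
      _ = _ := by ring
  have hx1 := abs_le_one_of_sum_rpow_le hu hx
  have hy1 := abs_le_one_of_sum_rpow_le hu hy
  set p := ∫ τ in Set.Ioc (0 : ℝ) 1, P τ with hp
  have hp0 : 0 ≤ p := setIntegral_nonneg measurableSet_Ioc hP0
  have hABint : ∀ A B : ℝ, IntegrableOn (fun τ => A * P τ + B * Q τ) (Set.Ioc 0 1) :=
    fun A B => (hPint.const_mul A).add (hQint.const_mul B)
  have hAB : ∀ A B : ℝ, ∫ τ in Set.Ioc (0 : ℝ) 1, (A * P τ + B * Q τ) = A * p + B * q := by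
    intro A B
    rw [integral_add (hPint.const_mul A) (hQint.const_mul B), integral_const_mul A P,
      integral_const_mul B Q, hQ]
  have hdis : ∀ τ τ', Disjoint (patSupp (levelPattern x τ)) (patSupp (levelPattern y τ')) := by
    intro τ τ'
    rw [Finset.disjoint_left]
    intro j hj hj'
    rcases hxy j with h | h
    · exact patSupp_levelPattern_subset x hj h
    · exact patSupp_levelPattern_subset y hj' h
  have step1 : ∀ τ' ∈ Set.Ioc (0 : ℝ) 1,
      ∑ i, (∑ j, boolSign (G i j) * x j) * patDot (G i) (levelPattern y τ') ≤
        4 * (√κ * Q τ' + P τ') * p + 4 * (√κ * P τ') * q := by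
    intro τ' hτ'
    have e : ∀ z : Fin N → ℝ,
        ∑ i, (∑ j, boolSign (G i j) * z j) * patDot (G i) (levelPattern y τ') =
        ∑ j, (∑ i, boolSign (G i j) * patDot (G i) (levelPattern y τ')) * z j := by
      intro z
      simp_rw [Finset.sum_mul]
      rw [Finset.sum_comm]
      exact Finset.sum_congr rfl fun j _ => Finset.sum_congr rfl fun i _ => by ring
    rw [e]
    rw [← hAB]
    refine sum_mul_le_setIntegral _ x hx1 (hABint _ _) fun τ hτ => ?_
    rw [← e]
    refine (hG (levelPattern x τ) (levelPattern y τ') (hdis τ τ')).trans ?_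
    have := gP x hx τ hτ
    have := gP y hy τ' hτ'
    have := gQ x hx τ hτ
    have := gQ y hy τ' hτ'
    have := hP0 τ hτ
    have := hP0 τ' hτ'
    have := patGauge_nonneg N α (patSupp (levelPattern x τ)).card
    have := patGauge_nonneg N α (patSupp (levelPattern y τ')).card
    calc _ ≤ 4 * (√κ * (P τ * Q τ' + P τ' * Q τ) + P τ * P τ') := by gcongr
      _ = _ := by ring
  have e2 : ∀ z : Fin N → ℝ,
      ∑ i, (∑ j, boolSign (G i j) * x j) * (∑ j, boolSign (G i j) * z j) =
      ∑ j, (∑ i, (∑ j, boolSign (G i j) * x j) * boolSign (G i j)) * z j := by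
    intro z
    simp_rw [Finset.mul_sum]
    rw [Finset.sum_comm]
    refine Finset.sum_congr rfl fun j _ => ?_
    rw [Finset.sum_mul]
    exact Finset.sum_congr rfl fun i _ => by ring
  have step2 : ∑ i, (∑ j, boolSign (G i j) * x j) * (∑ j, boolSign (G i j) * y j) ≤
      4 * (√κ * q + p) * p + 4 * (√κ * p) * q := by
    rw [e2, ← hAB]
    refine sum_mul_le_setIntegral _ y hy1 (hABint _ _) fun τ hτ => ?_
    rw [← e2]
    refine (step1 τ hτ).trans (le_of_eq ?_)
    ring
  refine step2.trans ?_
  have hn : 0 < (N : ℝ) ^ α := by positivity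
  calc 4 * (√κ * q + p) * p + 4 * (√κ * p) * q
      = 4 * (√κ * (p * q + p * q) + p * p) := by ring
    _ ≤ 4 * (√κ * (K * (N : ℝ) ^ α * q + K * (N : ℝ) ^ α * q) +
          K * (N : ℝ) ^ α * (K * (2 * √κ))) := by
        gcongr
        exact hP.trans (by gcongr)
    _ = _ := by ring

end LayerCake

section Decoupling

variable {ι : Type*} [Fintype ι] [DecidableEq ι]

lemma four_mul_sum_bool_ite {j l : ι} (hjl : j ≠ l) :
    4 * ∑ S : ι → Bool, (if S j then if S l then 0 else 1 else 0 : ℝ) =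
      (Fintype.card (ι → Bool) : ℝ) := by
  have hj : ∑ S : ι → Bool, (if S j then if S l then 0 else 1 else 0 : ℝ) =
      ∑ S : ι → Bool, (if S j then 0 else if S l then 0 else 1 : ℝ) := by
    refine Fintype.sum_equiv (Equiv.piCongrRight fun i =>
      if i = j then Equiv.boolNot else Equiv.refl Bool) _ _ fun S => ?_
    cases h : S j <;> simp [h, hjl.symm]
  have hl : ∑ S : ι → Bool, (if S l then 0 else 1 : ℝ) =
      ∑ S : ι → Bool, (if S l then 1 else 0 : ℝ) := by
    refine Fintype.sum_equiv (Equiv.piCongrRight fun i =>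
      if i = l then Equiv.boolNot else Equiv.refl Bool) _ _ fun S => ?_
    cases h : S l <;> simp [h]
  have h1 : ∑ S : ι → Bool, (if S j then if S l then 0 else 1 else 0 : ℝ) +
      ∑ S : ι → Bool, (if S j then 0 else if S l then 0 else 1 : ℝ) =
      ∑ S : ι → Bool, (if S l then 0 else 1 : ℝ) := by
    rw [← Finset.sum_add_distrib]
    exact Finset.sum_congr rfl fun S _ => by cases S j <;> simp
  have h2 : ∑ S : ι → Bool, (if S l then 0 else 1 : ℝ) +
      ∑ S : ι → Bool, (if S l then 1 else 0 : ℝ) = (Fintype.card (ι → Bool) : ℝ) := by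
    rw [← Finset.sum_add_distrib, Finset.sum_congr rfl (g := fun _ => (1 : ℝ))
      fun S _ => by cases S l <;> simp]
    simp
  linarith

/-- Decoupling: a bilinear form with zero diagonal is controlled by its values on disjointly
supported vectors. -/
lemma sum_sum_mul_le_of_disjoint {u K : ℝ} (hu : 0 < u) {b : ι → ι → ℝ} (hb : ∀ j, b j j = 0)
    (h : ∀ x y : ι → ℝ, ∑ j, |x j| ^ u ≤ 1 → ∑ j, |y j| ^ u ≤ 1 → (∀ j, x j = 0 ∨ y j = 0) →
      ∑ j, ∑ l, b j l * x j * y l ≤ K) {x y : ι → ℝ}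
    (hx : ∑ j, |x j| ^ u ≤ 1) (hy : ∑ j, |y j| ^ u ≤ 1) :
    ∑ j, ∑ l, b j l * x j * y l ≤ 4 * K := by
  have hcut : ∀ (z : ι → ℝ) (p : ι → Prop) [DecidablePred p], ∑ j, |z j| ^ u ≤ 1 →
      ∑ j, |if p j then z j else 0| ^ u ≤ 1 := by
    intro z p _ hz
    refine le_trans (Finset.sum_le_sum fun j _ => ?_) hz
    split_ifs
    · exact le_rfl
    · rw [abs_zero, Real.zero_rpow hu.ne']; positivity
  have hS : ∀ S : ι → Bool, ∑ j, ∑ l, b j l * x j * y l *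
      (if S j then if S l then 0 else 1 else 0 : ℝ) ≤ K := by
    intro S
    refine le_trans (le_of_eq ?_) (h (fun j => if S j = true then x j else 0)
      (fun j => if ¬ S j = true then y j else 0) (hcut x _ hx) (hcut y _ hy) fun j => ?_)
    · refine Finset.sum_congr rfl fun j _ => Finset.sum_congr rfl fun l _ => ?_
      cases S j <;> cases S l <;> simp
    · cases S j <;> simp
  have hsum := Finset.sum_le_sum fun S (_ : S ∈ (Finset.univ : Finset (ι → Bool))) => hS S
  rw [Finset.sum_const, Finset.card_univ, nsmul_eq_mul, Finset.sum_comm] at hsum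
  have e : ∀ j l, 4 * ∑ S : ι → Bool, b j l * x j * y l *
      (if S j then if S l then 0 else 1 else 0 : ℝ) =
      (Fintype.card (ι → Bool) : ℝ) * (b j l * x j * y l) := by
    intro j l
    rcases eq_or_ne j l with rfl | hjl
    · simp [hb]
    · rw [← Finset.mul_sum, mul_left_comm, four_mul_sum_bool_ite hjl, mul_comm]
  have hcard : (0 : ℝ) < Fintype.card (ι → Bool) := by exact_mod_cast Fintype.card_pos
  refine le_of_mul_le_mul_left ?_ hcard
  calc (Fintype.card (ι → Bool) : ℝ) * ∑ j, ∑ l, b j l * x j * y l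
      = 4 * ∑ j, ∑ S : ι → Bool, ∑ l, b j l * x j * y l *
          (if S j then if S l then 0 else 1 else 0 : ℝ) := by
        rw [Finset.mul_sum, Finset.mul_sum]
        refine Finset.sum_congr rfl fun j _ => ?_
        rw [Finset.sum_comm, Finset.mul_sum, Finset.mul_sum]
        exact Finset.sum_congr rfl fun l _ => (e j l).symm
    _ ≤ 4 * ((Fintype.card (ι → Bool) : ℝ) * K) := by gcongr
    _ = _ := by ring

end Decoupling

section Duality

variable {ι : Type*} [Fintype ι]

/-- A real bilinear form bounded on the unit ball of `ℓ_u` induces a complex operator from `ℓ_u`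
to the dual space `ℓ_t`. -/
lemma sum_norm_rpow_le_of_bilin {t u K : ℝ} (hu : 0 < u) (ht : 0 < t) (htu : 1 / t + 1 / u = 1)
    {b : ι → ι → ℝ}
    (h : ∀ x y : ι → ℝ, ∑ j, |x j| ^ u ≤ 1 → ∑ j, |y j| ^ u ≤ 1 →
      ∑ j, ∑ l, b j l * x j * y l ≤ K) {z : ι → ℂ} (hz : ∑ j, ‖z j‖ ^ u ≤ 1) :
    ∑ j, ‖∑ l, (b j l : ℂ) * z l‖ ^ t ≤ (2 * K) ^ t := by
  set w : ι → ℂ := fun j => ∑ l, (b j l : ℂ) * z l with hw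
  have habs : ∀ (g y : ι → ℝ), (∀ j, 0 ≤ g j) → ∑ j, g j ^ u ≤ 1 → ∑ j, |y j| ^ u ≤ 1 →
      ∑ j, g j * |∑ l, b j l * y l| ≤ K := by
    intro g y hg0 hg hy
    refine le_trans (le_of_eq ?_)
      (h (fun j => g j * (if 0 ≤ ∑ l, b j l * y l then 1 else -1)) y ?_ hy)
    · refine Finset.sum_congr rfl fun j _ => ?_
      have : ∀ s : ℝ, ∑ l, b j l * (g j * s) * y l = g j * (s * ∑ l, b j l * y l) := by
        intro s
        rw [Finset.mul_sum, Finset.mul_sum]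
        exact Finset.sum_congr rfl fun l _ => by ring
      rw [this]
      split_ifs with h0
      · rw [abs_of_nonneg h0, one_mul]
      · rw [abs_of_neg (not_le.1 h0), neg_one_mul]
    · refine le_trans (Finset.sum_le_sum fun j _ => le_of_eq ?_) hg
      split_ifs <;> simp [abs_of_nonneg (hg0 j)]
  have hdual : ∀ g : ι → ℝ, (∀ j, 0 ≤ g j) → ∑ j, g j ^ u ≤ 1 → ∑ j, g j * ‖w j‖ ≤ 2 * K := by
    intro g hg0 hg
    have hre := habs g (fun l => (z l).re) hg0 hg
      (le_trans (Finset.sum_le_sum fun j _ => by gcongr; exact Complex.abs_re_le_norm _) hz)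
    have him := habs g (fun l => (z l).im) hg0 hg
      (le_trans (Finset.sum_le_sum fun j _ => by gcongr; exact Complex.abs_im_le_norm _) hz)
    have hle : ∑ j, g j * ‖w j‖ ≤ ∑ j, g j * |∑ l, b j l * (z l).re| +
        ∑ j, g j * |∑ l, b j l * (z l).im| := by
      rw [← Finset.sum_add_distrib]
      refine Finset.sum_le_sum fun j _ => ?_
      rw [← mul_add]
      refine mul_le_mul_of_nonneg_left ?_ (hg0 j)
      refine (Complex.norm_le_abs_re_add_abs_im _).trans (le_of_eq ?_)
      simp [hw]
    linarith
  set W := ∑ j, ‖w j‖ ^ t with hW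
  have hW0 : 0 ≤ W := by positivity
  have hK : 0 ≤ 2 * K := by
    simpa using hdual (fun _ => 0) (fun _ => le_rfl) (by simp [Real.zero_rpow hu.ne'])
  rcases hW0.eq_or_lt with h0 | hpos
  · rw [← h0]; positivity
  have hWt : W ^ (1 / t) ≤ 2 * K := by
    refine le_trans (le_of_eq ?_) (hdual (fun j => ‖w j‖ ^ (t - 1) / W ^ (1 / u))
      (fun j => by positivity) ?_)
    · have e : ∀ j, ‖w j‖ ^ (t - 1) / W ^ (1 / u) * ‖w j‖ = ‖w j‖ ^ t / W ^ (1 / u) := by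
        intro j
        rcases (norm_nonneg (w j)).eq_or_lt with h | h
        · rw [← h, Real.zero_rpow ht.ne']; simp
        · rw [Real.rpow_sub_one h.ne']; field_simp
      rw [Finset.sum_congr rfl fun j _ => e j, ← Finset.sum_div, ← hW, eq_div_iff (by positivity),
        ← Real.rpow_add hpos, htu, Real.rpow_one]
    · have e : ∀ j, (‖w j‖ ^ (t - 1) / W ^ (1 / u)) ^ u = ‖w j‖ ^ t / W := by
        intro j
        rw [Real.div_rpow (by positivity) (by positivity), ← Real.rpow_mul (norm_nonneg _),
          ← Real.rpow_mul hW0]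
        have h1 : (t - 1) * u = t := by field_simp at htu; linarith
        have h2 : 1 / u * u = 1 := by field_simp
        rw [h1, h2, Real.rpow_one]
      rw [Finset.sum_congr rfl fun j _ => e j, ← Finset.sum_div, ← hW, div_self hpos.ne']
  calc W = (W ^ (1 / t)) ^ t := by
        rw [← Real.rpow_mul hW0, one_div_mul_cancel ht.ne', Real.rpow_one]
    _ ≤ _ := by gcongr

end Duality

section Approximation

lemma sum_norm_rpow_le_of_exponent_le {ι : Type*} [Fintype ι] {E : Type*} [NormedAddCommGroup E]
    {r s R : ℝ} (hr : 0 < r) (hrs : r ≤ s) (hR : 0 ≤ R) {w : ι → E}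
    (hw : ∑ j, ‖w j‖ ^ r ≤ R ^ r) : ∑ j, ‖w j‖ ^ s ≤ R ^ s := by
  have hle : ∀ j, ‖w j‖ ≤ R := fun j =>
    (Real.rpow_le_rpow_iff (norm_nonneg _) hR hr).1
      ((Finset.single_le_sum (f := fun j => ‖w j‖ ^ r) (fun _ _ => by positivity)
        (Finset.mem_univ j)).trans hw)
  calc ∑ j, ‖w j‖ ^ s ≤ ∑ j, R ^ (s - r) * ‖w j‖ ^ r := by
        refine Finset.sum_le_sum fun j _ => ?_
        calc ‖w j‖ ^ s = ‖w j‖ ^ (s - r) * ‖w j‖ ^ r := by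
              rw [← Real.rpow_add_of_nonneg (norm_nonneg _) (by linarith) hr.le, sub_add_cancel]
          _ ≤ _ := by gcongr; exact hle j
    _ = R ^ (s - r) * ∑ j, ‖w j‖ ^ r := by rw [Finset.mul_sum]
    _ ≤ R ^ (s - r) * R ^ r := by gcongr
    _ = R ^ s := by rw [← Real.rpow_add_of_nonneg hR (by linarith) hr.le, sub_add_cancel]

lemma piLp_norm_le_of_sum_rpow_le {ι : Type*} [Fintype ι] {E : Type*} [NormedAddCommGroup E]
    {p : ℝ≥0∞} [Fact (1 ≤ p)] {r R : ℝ} (hr : 0 < r) (hrp : ENNReal.ofReal r ≤ p) (hR : 0 ≤ R)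
    (w : PiLp p (fun _ : ι => E)) (hw : ∑ j, ‖w j‖ ^ r ≤ R ^ r) : ‖w‖ ≤ R := by
  rcases eq_or_ne p ∞ with rfl | hp
  · rw [PiLp.norm_eq_ciSup]
    refine Real.iSup_le (fun j => ?_) hR
    exact (Real.rpow_le_rpow_iff (norm_nonneg _) hR hr).1
      ((Finset.single_le_sum (f := fun j => ‖w j‖ ^ r) (fun _ _ => by positivity)
        (Finset.mem_univ j)).trans hw)
  · have hrp' : r ≤ p.toReal := (ENNReal.ofReal_le_iff_le_toReal hp).1 hrp
    have hp0 : 0 < p.toReal := hr.trans_le hrp'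
    rw [PiLp.norm_eq_sum hp0]
    have := sum_norm_rpow_le_of_exponent_le hr hrp' hR hw
    calc _ ≤ (R ^ p.toReal) ^ (1 / p.toReal) := by gcongr
      _ = R := by rw [← Real.rpow_mul hR, mul_one_div_cancel hp0.ne', Real.rpow_one]

lemma sum_rpow_le_of_piLp_norm_le {ι : Type*} [Fintype ι] {E : Type*} [NormedAddCommGroup E]
    {p : ℝ≥0∞} [Fact (1 ≤ p)] {s R : ℝ} (hp : p ≠ ∞) (hps : p.toReal ≤ s)
    (w : PiLp p (fun _ : ι => E)) (hw : ‖w‖ ≤ R) : ∑ j, ‖w j‖ ^ s ≤ R ^ s := by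
  have hp0 : 0 < p.toReal := ENNReal.toReal_pos (zero_lt_one.trans_le Fact.out).ne' hp
  have hR : 0 ≤ R := (norm_nonneg _).trans hw
  refine sum_norm_rpow_le_of_exponent_le hp0 hps hR ?_
  rw [PiLp.norm_eq_sum hp0] at hw
  have h0 : 0 ≤ ∑ j, ‖w j‖ ^ p.toReal := by positivity
  calc _ = ((∑ j, ‖w j‖ ^ p.toReal) ^ (1 / p.toReal)) ^ p.toReal := by
        rw [← Real.rpow_mul h0, one_div_mul_cancel hp0.ne', Real.rpow_one]
    _ ≤ _ := by gcongr

/-- The operator between `ℓ_p` spaces given by a matrix. -/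
noncomputable def matrixLp (p₁ p₂ : ℝ≥0∞) [Fact (1 ≤ p₁)] [Fact (1 ≤ p₂)] {N : ℕ}
    (M : Matrix (Fin N) (Fin N) ℂ) :
    PiLp p₁ (fun _ : Fin N => ℂ) →L[ℂ] PiLp p₂ (fun _ : Fin N => ℂ) :=
  LinearMap.toContinuousLinearMap
    (((WithLp.linearEquiv p₂ ℂ (Fin N → ℂ)).symm.toLinearMap).comp
      ((Matrix.mulVecLin M).comp (WithLp.linearEquiv p₁ ℂ (Fin N → ℂ)).toLinearMap))

lemma matrixLp_apply (p₁ p₂ : ℝ≥0∞) [Fact (1 ≤ p₁)] [Fact (1 ≤ p₂)] {N : ℕ}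
    (M : Matrix (Fin N) (Fin N) ℂ) (x : PiLp p₁ (fun _ : Fin N => ℂ)) (j : Fin N) :
    matrixLp p₁ p₂ M x j = ∑ l, M j l * x l := rfl

lemma rank_range_matrixLp_le (p₁ p₂ : ℝ≥0∞) [Fact (1 ≤ p₁)] [Fact (1 ≤ p₂)] {N κ : ℕ}
    (H : Matrix (Fin N) (Fin κ) ℂ) (L : Matrix (Fin κ) (Fin N) ℂ) :
    Module.rank ℂ (LinearMap.range (matrixLp p₁ p₂ (H * L) :
      PiLp p₁ (fun _ : Fin N => ℂ) →ₗ[ℂ] PiLp p₂ (fun _ : Fin N => ℂ))) ≤ (κ : Cardinal) := by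
  have e : (matrixLp p₁ p₂ (H * L) :
      PiLp p₁ (fun _ : Fin N => ℂ) →ₗ[ℂ] PiLp p₂ (fun _ : Fin N => ℂ)) =
      (((WithLp.linearEquiv p₂ ℂ (Fin N → ℂ)).symm.toLinearMap).comp (Matrix.mulVecLin H)).comp
        ((Matrix.mulVecLin L).comp (WithLp.linearEquiv p₁ ℂ (Fin N → ℂ)).toLinearMap) := by
    simp only [matrixLp, Matrix.mulVecLin_mul]
    rfl
  rw [e]
  refine (Submodule.rank_mono (LinearMap.range_comp_le_range _ _)).trans ?_
  refine (rank_range_le _).trans ?_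
  simp

lemma approxNumber_le {X Y : Type*} [NormedAddCommGroup X] [NormedSpace ℂ X]
    [NormedAddCommGroup Y] [NormedSpace ℂ Y] (T A : X →L[ℂ] Y) {k : ℕ}
    (hA : Module.rank ℂ (LinearMap.range (A : X →ₗ[ℂ] Y)) < (k : Cardinal)) :
    approxNumber T k ≤ ‖T - A‖ :=
  csInf_le ⟨0, by rintro r ⟨B, -, rfl⟩; exact norm_nonneg _⟩ ⟨A, hA, rfl⟩

end Approximation

section UpperBound

variable (p₁ p₂ : ℝ≥0∞) [Fact (1 ≤ p₁)] [Fact (1 ≤ p₂)]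

lemma lpId_apply (N : ℕ) (x : PiLp p₁ (fun _ : Fin N => ℂ)) (j : Fin N) :
    lpId p₁ p₂ N x j = x j := rfl

lemma norm_lpId_le_one_s1 {t u : ℝ} (hu : 0 < u) (hut : u ≤ t) (h₁ : p₁ ≠ ∞) (h₁u : p₁.toReal ≤ u)
    (h₂t : ENNReal.ofReal t ≤ p₂) (N : ℕ) : ‖lpId p₁ p₂ N‖ ≤ 1 := by
  refine ContinuousLinearMap.opNorm_le_bound _ zero_le_one fun x => ?_
  rw [one_mul]
  refine piLp_norm_le_of_sum_rpow_le (hu.trans_le hut) h₂t (norm_nonneg _) _ ?_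
  exact sum_norm_rpow_le_of_exponent_le hu hut (norm_nonneg _)
    (sum_rpow_le_of_piLp_norm_le h₁ h₁u x le_rfl)

lemma approxNumber_lpId_le_one {t u : ℝ} (hu : 0 < u) (hut : u ≤ t) (h₁ : p₁ ≠ ∞)
    (h₁u : p₁.toReal ≤ u) (h₂t : ENNReal.ofReal t ≤ p₂) (N : ℕ) {k : ℕ} (hk : 1 ≤ k) :
    approxNumber (lpId p₁ p₂ N) k ≤ 1 := by
  have h := norm_lpId_le_one_s1 p₁ p₂ hu hut h₁ h₁u h₂t N
  rw [← sub_zero (lpId p₁ p₂ N)] at h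
  refine (approxNumber_le _ 0 ?_).trans h
  rw [ContinuousLinearMap.toLinearMap_zero, LinearMap.range_zero, rank_bot]
  exact_mod_cast hk

/-- The upper bound for the approximation numbers of `ℓ_{p₁}^N → ℓ_{p₂}^N`. -/
lemma exists_approxNumber_lpId_le {t u : ℝ} (ht : 2 < t) (htu : 1 / t + 1 / u = 1) (hu : 0 < u)
    (h₁ : p₁ ≠ ∞) (h₁u : p₁.toReal ≤ u) (h₂t : ENNReal.ofReal t ≤ p₂) :
    ∃ c : ℝ, 1 ≤ c ∧ ∀ N k : ℕ, 1 ≤ k → 4 * k ≤ N →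
      approxNumber (lpId p₁ p₂ N) k ≤
        c * min 1 ((N : ℝ) ^ (1 / t) * (k : ℝ) ^ (-(1/2) : ℝ)) := by
  have ht0 : 0 < t := by linarith
  have hut : u ≤ t := by
    have h1 : 1 / t < 1 / 2 := by rw [div_lt_div_iff₀ ht0 two_pos]; linarith
    have h2 : 1 / t ≤ 1 / u := by linarith
    exact (one_div_le_one_div ht0 hu).1 h2
  obtain ⟨C, hC0, hC⟩ := exists_signMatrix_disjoint_le ht htu hu
  refine ⟨max 1 (16 * C), le_max_left _ _, fun N k hk hkN => ?_⟩
  have hle1 := approxNumber_lpId_le_one p₁ p₂ hu hut h₁ h₁u h₂t N hk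
  have hk0 : (0 : ℝ) < k := by exact_mod_cast hk
  have hN1 : (1 : ℝ) ≤ N := by exact_mod_cast (by omega : 1 ≤ N)
  have hkr : (k : ℝ) ^ (-(1/2) : ℝ) = (√k)⁻¹ := by
    rw [Real.rpow_neg hk0.le, Real.sqrt_eq_rpow]
  rw [hkr]
  rcases le_total 1 ((N : ℝ) ^ (1 / t) * (√k)⁻¹) with hθ | hθ
  · rw [min_eq_left hθ, mul_one]
    exact hle1.trans (le_max_left _ _)
  rw [min_eq_right hθ]
  have hk2 : 2 ≤ k := by
    by_contra! hcon
    have hk1 : k = 1 := by omega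
    subst hk1
    have h4 : (4 : ℝ) ≤ N := by exact_mod_cast hkN
    have : 1 < (N : ℝ) ^ (1 / t) := Real.one_lt_rpow (by linarith) (by positivity)
    simp at hθ
    rw [one_div] at this
    linarith
  obtain ⟨κ, rfl⟩ : ∃ κ, k = κ + 1 := ⟨k - 1, by omega⟩
  have hκ : 0 < κ := by omega
  have hκ0 : (0 : ℝ) < κ := by exact_mod_cast hκ
  have hsqrt : √((κ + 1 : ℕ) : ℝ) ≤ 2 * √κ := by
    rw [Real.sqrt_le_left (by positivity), mul_pow, Real.sq_sqrt hκ0.le]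
    have : (1 : ℝ) ≤ κ := by exact_mod_cast hκ
    push_cast; linarith
  have hNκ : (N : ℝ) ^ (1 / t) ≤ 2 * √κ := by
    refine le_trans ?_ hsqrt
    rwa [← div_eq_mul_inv, div_le_one (by positivity)] at hθ
  obtain ⟨G, hG⟩ := hC N κ hκ hNκ
  set K := C * ((N : ℝ) ^ (1 / t) / √κ) with hK
  set b : Fin N → Fin N → ℝ := fun j l =>
    (κ : ℝ)⁻¹ * ∑ i, boolSign (G i j) * boolSign (G i l) - if j = l then 1 else 0 with hb
  have hbdiag : ∀ j, b j j = 0 := by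
    intro j
    simp [hb, boolSign_mul_self, hκ0.ne']
  have hbdis : ∀ x y : Fin N → ℝ, ∑ j, |x j| ^ u ≤ 1 → ∑ j, |y j| ^ u ≤ 1 →
      (∀ j, x j = 0 ∨ y j = 0) → ∑ j, ∑ l, b j l * x j * y l ≤ K := by
    intro x y hx hy hxy
    have e : ∑ j, ∑ l, b j l * x j * y l =
        (κ : ℝ)⁻¹ * ∑ i, (∑ j, boolSign (G i j) * x j) * (∑ j, boolSign (G i j) * y j) := by
      have e1 : ∀ j l, b j l * x j * y l =
          (κ : ℝ)⁻¹ * ∑ i, (boolSign (G i j) * x j) * (boolSign (G i l) * y l) := by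
        intro j l
        have e0 : (if j = l then (1 : ℝ) else 0) * (x j * y l) = 0 := by
          rcases eq_or_ne j l with rfl | hjl
          · rcases hxy j with h | h <;> simp [h]
          · simp [hjl]
        rw [hb]
        simp only
        rw [sub_mul, sub_mul, mul_assoc _ (x j), mul_assoc (if j = l then _ else _), e0, sub_zero,
          mul_assoc, Finset.sum_mul]
        congr 1
        exact Finset.sum_congr rfl fun i _ => by ring
      simp_rw [e1, ← Finset.mul_sum]
      congr 1
      simp_rw [Finset.sum_mul_sum]
      rw [Finset.sum_comm (s := (Finset.univ : Finset (Fin κ)))]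
      exact Finset.sum_congr rfl fun j _ => Finset.sum_comm
    rw [e]
    calc _ ≤ (κ : ℝ)⁻¹ * (C * (√κ * (N : ℝ) ^ (1 / t))) := by
          gcongr; exact hG x y hx hy hxy
      _ = K := by
          rw [hK]
          have h1 : (κ : ℝ) = √κ * √κ := (Real.mul_self_sqrt hκ0.le).symm
          have h2 : √(κ : ℝ) ≠ 0 := by positivity
          rw [show (κ : ℝ)⁻¹ = (√κ * √κ)⁻¹ by rw [← h1]]
          field_simp
  have hK0 : 0 ≤ K := by positivity
  let H : Matrix (Fin N) (Fin κ) ℂ := fun j i => ((κ : ℝ)⁻¹ * boolSign (G i j) : ℝ)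
  let L : Matrix (Fin κ) (Fin N) ℂ := fun i l => (boolSign (G i l) : ℝ)
  have hnorm : ‖lpId p₁ p₂ N - matrixLp p₁ p₂ (H * L)‖ ≤ 2 * (4 * K) := by
    refine ContinuousLinearMap.opNorm_le_of_unit_norm (by positivity) fun x hx => ?_
    refine piLp_norm_le_of_sum_rpow_le ht0 h₂t (by positivity) _ ?_
    have hxu : ∑ j, ‖x j‖ ^ u ≤ 1 := by
      simpa using sum_rpow_le_of_piLp_norm_le h₁ h₁u x hx.le
    refine le_trans (le_of_eq ?_) (sum_norm_rpow_le_of_bilin hu ht0 htu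
      (fun x y => sum_sum_mul_le_of_disjoint hu hbdiag hbdis) hxu)
    refine Finset.sum_congr rfl fun j _ => ?_
    have e : (lpId p₁ p₂ N - matrixLp p₁ p₂ (H * L)) x j = -∑ l, (b j l : ℂ) * x l := by
      change lpId p₁ p₂ N x j - matrixLp p₁ p₂ (H * L) x j = _
      rw [matrixLp_apply, lpId_apply]
      have : ∀ l, (H * L) j l = (b j l : ℂ) + if j = l then 1 else 0 := by
        intro l
        rw [Matrix.mul_apply]
        simp only [H, L, hb]
        push_cast
        rw [Finset.mul_sum]
        split_ifs <;> simp [mul_assoc]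
      simp_rw [this, add_mul, Finset.sum_add_distrib]
      simp
    rw [e, norm_neg]
  refine (approxNumber_le _ (matrixLp p₁ p₂ (H * L)) ?_).trans (hnorm.trans ?_)
  · refine (rank_range_matrixLp_le p₁ p₂ H L).trans_lt ?_
    exact_mod_cast Nat.lt_succ_self κ
  · have hinv : (√κ)⁻¹ ≤ 2 * (√((κ + 1 : ℕ) : ℝ))⁻¹ := by
      rw [← div_eq_mul_inv, inv_eq_one_div, div_le_div_iff₀ (by positivity) (by positivity)]
      linarith
    calc 2 * (4 * K) = 8 * C * ((N : ℝ) ^ (1 / t) * (√κ)⁻¹) := by rw [hK]; ring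
      _ ≤ 8 * C * ((N : ℝ) ^ (1 / t) * (2 * (√((κ + 1 : ℕ) : ℝ))⁻¹)) := by gcongr
      _ = 16 * C * ((N : ℝ) ^ (1 / t) * (√((κ + 1 : ℕ) : ℝ))⁻¹) := by ring
      _ ≤ _ := by gcongr; exact le_max_right _ _

end UpperBound

section LowerBound

/-- The trace of a matrix is controlled by the dimension of its column space and its
Hilbert–Schmidt norm. -/
lemma norm_trace_sq_le {ι : Type*} [Fintype ι] (M : ι → ι → ℂ)
    (V : Submodule ℂ (EuclideanSpace ℂ ι)) (hV : ∀ j, WithLp.toLp 2 (fun i => M i j) ∈ V) :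
    ‖∑ j, M j j‖ ^ 2 ≤ Module.finrank ℂ V * ∑ j, ∑ i, ‖M i j‖ ^ 2 := by
  let v := stdOrthonormalBasis ℂ V
  let w : ι → V := fun j => ⟨_, hV j⟩
  have hdiag : ∀ j, M j j = ∑ a, v.repr (w j) a * (v a : EuclideanSpace ℂ ι) j := by
    intro j
    have h := congrArg (fun z : V => (z : EuclideanSpace ℂ ι) j) (v.sum_repr (w j))
    simpa [w] using h.symm
  have hrepr : ∀ j, ∑ a, ‖v.repr (w j) a‖ ^ 2 = ∑ i, ‖M i j‖ ^ 2 := by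
    intro j
    rw [← EuclideanSpace.norm_sq_eq, LinearIsometryEquiv.norm_map, Submodule.coe_norm,
      EuclideanSpace.norm_sq_eq]
  have hone : ∑ j, ∑ a, ‖(v a : EuclideanSpace ℂ ι) j‖ ^ 2 = Module.finrank ℂ V := by
    rw [Finset.sum_comm]
    have : ∀ a, ∑ j, ‖(v a : EuclideanSpace ℂ ι) j‖ ^ 2 = 1 := by
      intro a
      rw [← EuclideanSpace.norm_sq_eq, ← Submodule.coe_norm, v.norm_eq_one, one_pow]
    simp [this]
  calc ‖∑ j, M j j‖ ^ 2
      ≤ (∑ j, ∑ a, ‖(v a : EuclideanSpace ℂ ι) j‖ * ‖v.repr (w j) a‖) ^ 2 := by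
        gcongr
        refine norm_sum_le_of_le _ fun j _ => ?_
        rw [hdiag j]
        exact norm_sum_le_of_le _ fun a _ => by rw [norm_mul, mul_comm]
    _ ≤ (∑ j, ∑ a, ‖(v a : EuclideanSpace ℂ ι) j‖ ^ 2) * ∑ j, ∑ a, ‖v.repr (w j) a‖ ^ 2 := by
        simp_rw [← Fintype.sum_prod_type']
        exact Finset.sum_mul_sq_le_sq_mul_sq _ _ _
    _ = _ := by rw [hone, Finset.sum_congr rfl fun j _ => hrepr j]

/-- The Hilbert–Schmidt distance from the identity to matrices of small rank with a nearly
constant diagonal. -/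
lemma le_sum_norm_sub_sq {N k : ℕ} (hkN : 4 * k ≤ N) (D : Fin N → Fin N → ℂ)
    (hdiag : ∀ j, ‖D j j‖ ≤ 1 / 4) (V : Submodule ℂ (EuclideanSpace ℂ (Fin N)))
    (hV : ∀ j, WithLp.toLp 2 (fun i => (if i = j then 1 else 0) - D i j) ∈ V)
    (hVk : Module.finrank ℂ V ≤ k) :
    (N : ℝ) ^ 2 ≤ 32 * k * ∑ j, ∑ i, ‖D i j‖ ^ 2 := by
  have h := norm_trace_sq_le (fun i j => (if i = j then 1 else 0) - D i j) V hV
  have htr : 3 / 4 * (N : ℝ) ≤ ‖∑ j, ((if j = j then 1 else 0) - D j j)‖ := by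
    have h1 : ∑ j, ((if j = j then 1 else 0) - D j j) = (N : ℂ) - ∑ j, D j j := by simp
    have h2 : ‖∑ j, D j j‖ ≤ N * (1 / 4) := by
      refine (norm_sum_le_of_le _ fun j _ => hdiag j).trans ?_
      simp
    have h3 := norm_sub_norm_le (N : ℂ) (∑ j, D j j)
    rw [h1]
    rw [Complex.norm_natCast] at h3
    linarith
  have hS : ∑ j, ∑ i, ‖(if i = j then 1 else 0) - D i j‖ ^ 2 ≤
      2 * N + 2 * ∑ j, ∑ i, ‖D i j‖ ^ 2 := by
    have e : (2 * N : ℝ) = 2 * ∑ j : Fin N, ∑ i : Fin N, (if i = j then (1 : ℝ) else 0) := by simp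
    rw [e, ← mul_add, ← Finset.sum_add_distrib, Finset.mul_sum]
    refine Finset.sum_le_sum fun j _ => ?_
    rw [← Finset.sum_add_distrib, Finset.mul_sum]
    refine Finset.sum_le_sum fun i _ => ?_
    have h1 : ‖(if i = j then 1 else 0) - D i j‖ ≤ ‖(if i = j then (1 : ℂ) else 0)‖ + ‖D i j‖ :=
      norm_sub_le _ _
    have h2 : ‖(if i = j then (1 : ℂ) else 0)‖ ^ 2 = if i = j then (1 : ℝ) else 0 := by
      split_ifs <;> simp
    rw [← h2]
    nlinarith [sq_nonneg (‖(if i = j then (1 : ℂ) else 0)‖ - ‖D i j‖), norm_nonneg (D i j),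
      norm_nonneg (if i = j then (1 : ℂ) else 0),
      norm_nonneg ((if i = j then (1 : ℂ) else 0) - D i j)]
  have hk' : (Module.finrank ℂ V : ℝ) ≤ k := by exact_mod_cast hVk
  have hkN' : 4 * (k : ℝ) ≤ N := by exact_mod_cast hkN
  have h4 : (3 / 4 * (N : ℝ)) ^ 2 ≤ k * (2 * N + 2 * ∑ j, ∑ i, ‖D i j‖ ^ 2) := by
    calc _ ≤ ‖∑ j, ((if j = j then 1 else 0) - D j j)‖ ^ 2 := by gcongr
      _ ≤ _ := h.trans (by gcongr)
  have hN0 : (0 : ℝ) ≤ N := Nat.cast_nonneg _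
  nlinarith

/-- Comparison of the `ℓ_2` norm with `ℓ_p` for `p ≥ 2`. -/
lemma sum_norm_sq_le_piLp {ι : Type*} [Fintype ι] {p : ℝ≥0∞} [Fact (1 ≤ p)] (hp : 2 < p)
    (w : PiLp p (fun _ : ι => ℂ)) :
    ∑ j, ‖w j‖ ^ 2 ≤ (Fintype.card ι : ℝ) ^ (1 - 2 * p⁻¹.toReal) * ‖w‖ ^ 2 := by
  rcases eq_or_ne p ∞ with rfl | hp'
  · simp only [ENNReal.inv_top, ENNReal.toReal_zero, mul_zero, sub_zero, Real.rpow_one]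
    rw [← nsmul_eq_mul, ← Finset.card_univ, ← Finset.sum_const]
    gcongr with j
    exact PiLp.norm_apply_le w j
  have h2 : 2 < p.toReal := by
    have := (ENNReal.toReal_lt_toReal (by simp) hp').2 hp
    simpa using this
  set q := p.toReal with hq
  have hq0 : 0 < q := by linarith
  have h := Real.rpow_sum_le_const_mul_sum_rpow Finset.univ (fun j => ‖w j‖ ^ 2)
    (p := q / 2) (by linarith)
  have e : ∀ j, |‖w j‖ ^ 2| ^ (q / 2) = ‖w j‖ ^ q := by
    intro j
    rw [abs_of_nonneg (by positivity), ← Real.rpow_natCast, ← Real.rpow_mul (norm_nonneg _)]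
    congr 1
    push_cast; ring
  have e' : ∀ j, |‖w j‖ ^ 2| = ‖w j‖ ^ 2 := fun j => abs_of_nonneg (by positivity)
  simp_rw [e, e'] at h
  have hw : ∑ j, ‖w j‖ ^ q ≤ ‖w‖ ^ q := sum_rpow_le_of_piLp_norm_le hp' le_rfl w le_rfl
  have hn0 : (0 : ℝ) ≤ Fintype.card ι := Nat.cast_nonneg _
  rw [ENNReal.toReal_inv, ← hq]
  refine (Real.rpow_le_rpow_iff (by positivity) (by positivity) (z := q / 2) (by linarith)).1 ?_
  refine h.trans ?_
  rw [Real.mul_rpow (by positivity) (by positivity), ← Real.rpow_mul hn0, ← Real.rpow_natCast,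
    ← Real.rpow_mul (norm_nonneg _), Finset.card_univ]
  have e1 : (1 - 2 * q⁻¹) * (q / 2) = q / 2 - 1 := by field_simp
  have e2 : ((2 : ℕ) : ℝ) * (q / 2) = q := by push_cast; ring
  rw [e1, e2]
  gcongr

/-- Comparison of the `ℓ_2` norm with `ℓ_p` for `p ≤ 2`. -/
lemma piLp_norm_sq_le {ι : Type*} [Fintype ι] {p : ℝ≥0∞} [Fact (1 ≤ p)] (hp : p < 2)
    (w : PiLp p (fun _ : ι => ℂ)) :
    ‖w‖ ^ 2 ≤ (Fintype.card ι : ℝ) ^ (2 * p⁻¹.toReal - 1) * ∑ j, ‖w j‖ ^ 2 := by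
  have hp' : p ≠ ∞ := (hp.trans (by simp)).ne
  have h2 : p.toReal < 2 := by
    have := (ENNReal.toReal_lt_toReal hp' (by simp)).2 hp
    simpa using this
  have hq0 : 0 < p.toReal := ENNReal.toReal_pos (zero_lt_one.trans_le Fact.out).ne' hp'
  rw [PiLp.norm_eq_sum hq0, ENNReal.toReal_inv]
  set q := p.toReal with hq
  have h := Real.rpow_sum_le_const_mul_sum_rpow Finset.univ (fun j => ‖w j‖ ^ q)
    (p := 2 / q) (by rw [le_div_iff₀ hq0]; linarith)
  have e : ∀ j, |‖w j‖ ^ q| ^ (2 / q) = ‖w j‖ ^ 2 := by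
    intro j
    rw [abs_of_nonneg (by positivity), ← Real.rpow_mul (norm_nonneg _), ← Real.rpow_natCast]
    congr 1
    field_simp; norm_num
  have e' : ∀ j, |‖w j‖ ^ q| = ‖w j‖ ^ q := fun j => abs_of_nonneg (by positivity)
  simp_rw [e, e'] at h
  rw [← Real.rpow_natCast, ← Real.rpow_mul (by positivity)]
  have e1 : 1 / q * ((2 : ℕ) : ℝ) = 2 / q := by push_cast; ring
  rw [e1]
  rwa [div_eq_mul_inv, Finset.card_univ] at h

end LowerBound

section LowerBound

variable (p₁ p₂ : ℝ≥0∞) [Fact (1 ≤ p₁)] [Fact (1 ≤ p₂)]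

lemma piLp_eq_sum_single {p : ℝ≥0∞} {N : ℕ} (x : PiLp p (fun _ : Fin N => ℂ)) :
    x = ∑ l, x l • PiLp.single p l (1 : ℂ) := by
  ext j
  simp [Finset.sum_apply, Pi.single_apply]

/-- A low-rank approximation of `ℓ_{p₁}^N → ℓ_{p₂}^N` has a large error. -/
lemma le_norm_lpId_sub {N k : ℕ} (hk : 1 ≤ k) (hkN : 4 * k ≤ N) (h₁ : p₁ < 2) (h₂ : 2 < p₂)
    (A : PiLp p₁ (fun _ : Fin N => ℂ) →L[ℂ] PiLp p₂ (fun _ : Fin N => ℂ))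
    (hA : Module.rank ℂ (LinearMap.range (A : PiLp p₁ (fun _ : Fin N => ℂ) →ₗ[ℂ]
      PiLp p₂ (fun _ : Fin N => ℂ))) < (k : Cardinal)) :
    1 / 4 ≤ ‖lpId p₁ p₂ N - A‖ ∨
      (N : ℝ) ^ (2 * p₂⁻¹.toReal) ≤ 32 * k * ‖lpId p₁ p₂ N - A‖ ^ 2 ∧
      (N : ℝ) ^ (2 * (1 - p₁⁻¹.toReal)) ≤ 32 * k * ‖lpId p₁ p₂ N - A‖ ^ 2 := by
  rcases le_total (1 / 4) ‖lpId p₁ p₂ N - A‖ with hε | hε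
  · exact Or.inl hε
  right
  set E := lpId p₁ p₂ N - A with hE
  set ε := ‖E‖ with hεdef
  have hN0 : (0 : ℝ) < N := by exact_mod_cast (by omega : 0 < N)
  set D : Fin N → Fin N → ℂ := fun i j => E (PiLp.single p₁ j (1 : ℂ)) i with hD
  have hcol : ∀ j, ‖E (PiLp.single p₁ j (1 : ℂ))‖ ≤ ε := by
    intro j
    refine (E.le_opNorm _).trans ?_
    rw [PiLp.norm_single, norm_one, mul_one]
  let e : PiLp p₂ (fun _ : Fin N => ℂ) ≃ₗ[ℂ] EuclideanSpace ℂ (Fin N) :=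
    (WithLp.linearEquiv p₂ ℂ (Fin N → ℂ)).trans (WithLp.linearEquiv 2 ℂ (Fin N → ℂ)).symm
  let V := (LinearMap.range (A : PiLp p₁ (fun _ : Fin N => ℂ) →ₗ[ℂ]
      PiLp p₂ (fun _ : Fin N => ℂ))).map e.toLinearMap
  have hVk : Module.finrank ℂ V ≤ k := by
    have h1 : Module.finrank ℂ V = Module.finrank ℂ (LinearMap.range
        (A : PiLp p₁ (fun _ : Fin N => ℂ) →ₗ[ℂ] PiLp p₂ (fun _ : Fin N => ℂ))) :=
      LinearEquiv.finrank_map_eq e _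
    rw [h1]
    rw [← Module.finrank_eq_rank] at hA
    exact_mod_cast hA.le
  have hS := le_sum_norm_sub_sq hkN D (fun j => (PiLp.norm_apply_le _ j).trans ((hcol j).trans hε))
    V (fun j => by
      refine ⟨A (PiLp.single p₁ j (1 : ℂ)), ⟨_, rfl⟩, ?_⟩
      ext i
      have h1 : E (PiLp.single p₁ j (1 : ℂ)) i =
          lpId p₁ p₂ N (PiLp.single p₁ j (1 : ℂ)) i - A (PiLp.single p₁ j (1 : ℂ)) i := rfl
      have h2 : e (A (PiLp.single p₁ j (1 : ℂ))) i = A (PiLp.single p₁ j (1 : ℂ)) i := rfl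
      change e (A (PiLp.single p₁ j (1 : ℂ))) i = (if i = j then 1 else 0) - D i j
      rw [h2, hD]
      simp only
      rw [h1, lpId_apply, PiLp.single_apply]
      ring) hVk
  have hfinish : ∀ r : ℝ, ∑ j, ∑ i, ‖D i j‖ ^ 2 ≤ (N : ℝ) ^ (2 - r) * ε ^ 2 →
      (N : ℝ) ^ r ≤ 32 * k * ε ^ 2 := by
    intro r hr
    have h1 : (N : ℝ) ^ (2 - r) * (N : ℝ) ^ r = (N : ℝ) ^ 2 := by
      rw [← Real.rpow_add hN0, sub_add_cancel]; norm_cast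
    refine le_of_mul_le_mul_left ?_ (Real.rpow_pos_of_pos hN0 (2 - r))
    rw [h1]
    calc _ ≤ 32 * k * ((N : ℝ) ^ (2 - r) * ε ^ 2) := hS.trans (by gcongr)
      _ = _ := by ring
  have hcard : ∀ r c : ℝ, (N : ℝ) * ((N : ℝ) ^ r * c) = (N : ℝ) ^ (r + 1) * c := by
    intro r c
    rw [Real.rpow_add_one hN0.ne']; ring
  constructor
  · refine hfinish _ ?_
    have : ∀ j, ∑ i, ‖D i j‖ ^ 2 ≤ (N : ℝ) ^ (1 - 2 * p₂⁻¹.toReal) * ε ^ 2 := by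
      intro j
      have h := sum_norm_sq_le_piLp h₂ (E (PiLp.single p₁ j (1 : ℂ)))
      rw [Fintype.card_fin] at h
      refine h.trans ?_
      gcongr
      exact hcol j
    refine (Finset.sum_le_sum fun j _ => this j).trans (le_of_eq ?_)
    rw [Finset.sum_const, Finset.card_univ, Fintype.card_fin, nsmul_eq_mul, hcard]
    congr 2; ring
  · refine hfinish _ ?_
    rw [Finset.sum_comm]
    have : ∀ i, ∑ j, ‖D i j‖ ^ 2 ≤ (N : ℝ) ^ (2 * p₁⁻¹.toReal - 1) * ε ^ 2 := by
      intro i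
      set s := ∑ j, ‖D i j‖ ^ 2 with hs
      have hs0 : 0 ≤ s := by positivity
      let x : PiLp p₁ (fun _ : Fin N => ℂ) := WithLp.toLp p₁ fun j => (starRingEnd ℂ) (D i j)
      have hx := piLp_norm_sq_le h₁ x
      have hxs : ∑ j, ‖x j‖ ^ 2 = s := by simp [x, hs]
      rw [hxs, Fintype.card_fin] at hx
      have hEx : E x i = (s : ℂ) := by
        rw [piLp_eq_sum_single x, map_sum]
        simp only [map_smul]
        rw [hs]
        push_cast
        have : ∀ j, (x j • E (PiLp.single p₁ j (1 : ℂ))) i = (‖D i j‖ : ℂ) ^ 2 := by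
          intro j
          change (starRingEnd ℂ) (D i j) * D i j = _
          rw [Complex.conj_mul']
        simp [← this]
      have hle : s ≤ ε * ‖x‖ := by
        have h1 := (PiLp.norm_apply_le (E x) i).trans (E.le_opNorm x)
        rwa [hEx, Complex.norm_real, Real.norm_of_nonneg hs0] at h1
      rcases hs0.eq_or_lt with h0 | hpos
      · rw [← h0]; positivity
      refine le_of_mul_le_mul_left ?_ hpos
      calc s * s ≤ (ε * ‖x‖) * (ε * ‖x‖) := by gcongr
        _ = ε ^ 2 * ‖x‖ ^ 2 := by ring
        _ ≤ ε ^ 2 * ((N : ℝ) ^ (2 * p₁⁻¹.toReal - 1) * s) := by gcongr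
        _ = _ := by ring
    refine (Finset.sum_le_sum fun i _ => this i).trans (le_of_eq ?_)
    rw [Finset.sum_const, Finset.card_univ, Fintype.card_fin, nsmul_eq_mul, hcard]
    congr 2; ring

/-- The lower bound for the approximation numbers of `ℓ_{p₁}^N → ℓ_{p₂}^N`. -/
lemma le_approxNumber_lpId {N k : ℕ} (hk : 1 ≤ k) (hkN : 4 * k ≤ N) (h₁ : p₁ < 2) (h₂ : 2 < p₂)
    {r : ℝ} (hr : r = p₂⁻¹.toReal ∨ r = 1 - p₁⁻¹.toReal) :
    1 / 8 * min 1 ((N : ℝ) ^ r * (k : ℝ) ^ (-(1/2) : ℝ)) ≤ approxNumber (lpId p₁ p₂ N) k := by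
  have hk0 : (0 : ℝ) < k := by exact_mod_cast hk
  refine le_csInf ⟨_, 0, ?_, rfl⟩ ?_
  · rw [ContinuousLinearMap.toLinearMap_zero, LinearMap.range_zero, rank_bot]
    exact_mod_cast hk
  rintro _ ⟨A, hA, rfl⟩
  set ε := ‖lpId p₁ p₂ N - A‖ with hε
  have hε0 : 0 ≤ ε := norm_nonneg _
  rcases le_norm_lpId_sub p₁ p₂ hk hkN h₁ h₂ A hA with h | ⟨h, h'⟩
  · have := min_le_left (1 : ℝ) ((N : ℝ) ^ r * (k : ℝ) ^ (-(1/2) : ℝ))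
    linarith
  have hN : (N : ℝ) ^ (2 * r) ≤ 32 * k * ε ^ 2 := by
    rcases hr with rfl | rfl
    · exact h
    · exact h'
  have hle : (N : ℝ) ^ r * (k : ℝ) ^ (-(1/2) : ℝ) ≤ 8 * ε := by
    refine le_of_sq_le_sq ?_ (by positivity)
    have e1 : ((N : ℝ) ^ r) ^ 2 = (N : ℝ) ^ (2 * r) := by
      rw [← Real.rpow_natCast, ← Real.rpow_mul (Nat.cast_nonneg _), mul_comm]; norm_cast
    have e2 : ((k : ℝ) ^ (-(1/2) : ℝ)) ^ 2 = (k : ℝ)⁻¹ := by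
      rw [← Real.rpow_natCast, ← Real.rpow_mul hk0.le, ← Real.rpow_neg_one]; norm_num
    rw [mul_pow, e1, e2, ← div_eq_mul_inv, div_le_iff₀ hk0]
    nlinarith [sq_nonneg ε, mul_nonneg hk0.le (sq_nonneg ε)]
  have := min_le_right (1 : ℝ) ((N : ℝ) ^ r * (k : ℝ) ^ (-(1/2) : ℝ))
  linarith

end LowerBound

/-- The reciprocal of `min(p₁′, p₂)`. -/
lemma toReal_inv_min_conjExp {p₁ p₂ : ℝ≥0∞} (h₁ : 1 ≤ p₁) (h₂ : p₂ ≠ 0) :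
    (min (conjExp p₁) p₂)⁻¹.toReal = max (1 - p₁⁻¹.toReal) p₂⁻¹.toReal := by
  have hinv : (conjExp p₁)⁻¹ = 1 - p₁⁻¹ := by rw [conjExp, inv_inv]
  have hle : p₁⁻¹ ≤ 1 := ENNReal.inv_le_one.2 h₁
  have hsub : (1 - p₁⁻¹).toReal = 1 - p₁⁻¹.toReal := by
    rw [ENNReal.toReal_sub_of_le hle (by simp)]; simp
  have hne : 1 - p₁⁻¹ ≠ ∞ := (tsub_le_self.trans_lt (by simp)).ne
  have hne2 : p₂⁻¹ ≠ ∞ := by simpa using h₂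
  rw [← hsub, ← hinv]
  rcases le_total (conjExp p₁) p₂ with h | h
  · rw [min_eq_left h, max_eq_left]
    exact ENNReal.toReal_mono (hinv ▸ hne) (ENNReal.inv_le_inv.2 h)
  · rw [min_eq_right h, max_eq_right]
    exact ENNReal.toReal_mono hne2 (ENNReal.inv_le_inv.2 h)

/-- If `1 ≤ p₁ < 2 < p₂ ≤ ∞`, `(p₁, p₂) ≠ (1, ∞)` and `t = min(p₁′, p₂)`, then
`a_k(id : ℓ_{p₁}^N → ℓ_{p₂}^N) ∼ min(1, N^{1/t} k^{-1/2})` for `4k ≤ N`. -/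
theorem stmt1 (p₁ p₂ : ℝ≥0∞) [Fact (1 ≤ p₁)] [Fact (1 ≤ p₂)]
    (h₁ : p₁ < 2) (h₂ : 2 < p₂) (hne : ¬(p₁ = 1 ∧ p₂ = ∞)) :
    ∃ c₁ c₂ : ℝ, 0 < c₁ ∧ c₁ ≤ c₂ ∧
      ∀ N k : ℕ, 1 ≤ k → 4 * k ≤ N →
        c₁ * min 1 ((N : ℝ) ^ ((min (conjExp p₁) p₂)⁻¹.toReal) * (k : ℝ) ^ (-(1/2) : ℝ))
            ≤ approxNumber (lpId p₁ p₂ N) k ∧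
        approxNumber (lpId p₁ p₂ N) k
            ≤ c₂ * min 1 ((N : ℝ) ^ ((min (conjExp p₁) p₂)⁻¹.toReal) * (k : ℝ) ^ (-(1/2) : ℝ)) := by
  have hp₁ : (1 : ℝ≥0∞) ≤ p₁ := Fact.out
  have hp₂0 : p₂ ≠ 0 := (zero_le.trans_lt h₂).ne'
  have hp₁top : p₁ ≠ ∞ := (h₁.trans (by simp)).ne
  rw [toReal_inv_min_conjExp hp₁ hp₂0]
  set e := max (1 - p₁⁻¹.toReal) p₂⁻¹.toReal with he
  have hp₁pos : 0 < p₁.toReal := ENNReal.toReal_pos (zero_lt_one.trans_le hp₁).ne' hp₁top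
  have hp₁2 : p₁.toReal < 2 := by
    simpa using (ENNReal.toReal_lt_toReal hp₁top (by simp)).2 h₁
  have hp₁inv : p₁⁻¹.toReal = (p₁.toReal)⁻¹ := ENNReal.toReal_inv _
  have he2 : e < 1 / 2 := by
    refine max_lt ?_ ?_
    · rw [hp₁inv]
      have := (inv_lt_inv₀ two_pos hp₁pos).2 hp₁2
      norm_num at this ⊢; linarith
    · have := (ENNReal.toReal_lt_toReal (by simpa using hp₂0) (by simp)).2
        (ENNReal.inv_lt_inv.2 h₂)
      simpa using this
  have he0 : 0 < e := by
    rcases hp₁.eq_or_lt with h | h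
    · have hp₂top : p₂ ≠ ∞ := fun h' => hne ⟨h.symm, h'⟩
      refine lt_max_of_lt_right ?_
      exact ENNReal.toReal_pos (by simpa using hp₂top) (by simpa using hp₂0)
    · refine lt_max_of_lt_left ?_
      have h1 : 1 < p₁.toReal := by
        simpa using (ENNReal.toReal_lt_toReal (by simp) hp₁top).2 h
      rw [hp₁inv]
      have := inv_lt_one_of_one_lt₀ h1
      linarith
  obtain ⟨c, hc1, hc⟩ := exists_approxNumber_lpId_le p₁ p₂ (t := 1 / e) (u := 1 / (1 - e))
    (by rw [lt_div_iff₀ he0]; linarith) (by rw [one_div_one_div, one_div_one_div]; ring)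
    (by apply one_div_pos.2; linarith) hp₁top
    (by
      have h1 : 1 - e ≤ (p₁.toReal)⁻¹ := by
        have := le_max_left (1 - p₁⁻¹.toReal) p₂⁻¹.toReal
        rw [← hp₁inv]; linarith
      rw [le_div_iff₀ (by linarith)]
      calc _ ≤ p₁.toReal * (p₁.toReal)⁻¹ := by gcongr
        _ = 1 := mul_inv_cancel₀ hp₁pos.ne')
    (by
      rcases eq_or_ne p₂ ∞ with rfl | hp₂top
      · exact le_top
      have hpos : 0 < p₂.toReal := ENNReal.toReal_pos hp₂0 hp₂top
      rw [ENNReal.ofReal_le_iff_le_toReal hp₂top, div_le_iff₀ he0]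
      have h1 : (p₂.toReal)⁻¹ ≤ e := by
        rw [← ENNReal.toReal_inv]; exact le_max_right _ _
      calc 1 = p₂.toReal * (p₂.toReal)⁻¹ := (mul_inv_cancel₀ hpos.ne').symm
        _ ≤ _ := by gcongr)
  rw [one_div_one_div] at hc
  refine ⟨1 / 8, c, by norm_num, by linarith, fun N k hk hkN => ⟨?_, hc N k hk hkN⟩⟩
  refine le_approxNumber_lpId p₁ p₂ hk hkN h₁ h₂ ?_
  rcases max_choice (1 - p₁⁻¹.toReal) p₂⁻¹.toReal with h | h
  · exact Or.inr h
  · exact Or.inl h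
end

section
/- Let 1 ≤ p₂ < p₁ ≤ ∞. Then for every N ∈ ℕ and every k ∈ ℕ with k ≤ N one has the exact identity a_k(id : ℓ_{p₁}^N → ℓ_{p₂}^N) = (N − k + 1)^{1/p₂ − 1/p₁} (with the convention 1/∞ = 0). -/
open scoped ENNReal

open Filter Topology in
/-- A subspace `L` of `ℂ^N` contains a vector of the unit ball of `ℓ_∞^N` with at least `dim L`
unimodular coordinates, namely any extreme point of its unit ball. -/
theorem exists_mem_finrank_le_card_norm_eq_one {ι : Type*} [Fintype ι]
    (L : Submodule ℂ (ι → ℂ)) :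
    ∃ x ∈ L, (∀ i, ‖x i‖ ≤ 1) ∧
      Module.finrank ℂ L ≤ (Finset.univ.filter fun i => ‖x i‖ = 1).card := by
  have hK : IsCompact ((L : Set (ι → ℂ)) ∩ Metric.closedBall 0 1) :=
    (isCompact_closedBall 0 1).inter_left L.closed_of_finiteDimensional
  obtain ⟨x, hx⟩ := hK.extremePoints_nonempty ⟨0, by simp⟩
  have hmem : ∀ y : ι → ℂ, y ∈ Metric.closedBall (0 : ι → ℂ) 1 ↔ ∀ i, ‖y i‖ ≤ 1 := fun y => by
    rw [mem_closedBall_zero_iff, pi_norm_le_iff_of_nonneg zero_le_one]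
  have hxL : x ∈ L := hx.1.1
  have hx1 : ∀ i, ‖x i‖ ≤ 1 := (hmem x).1 hx.1.2
  refine ⟨x, hxL, hx1, ?_⟩
  by_contra! hlt
  set J := Finset.univ.filter fun i => ‖x i‖ = 1 with hJ
  obtain ⟨⟨y, hyL⟩, hyJ, hy0⟩ := Submodule.exists_mem_ne_zero_of_ne_bot
    (LinearMap.ker_ne_bot_of_finrank_lt
      (f := (LinearMap.funLeft ℂ ℂ (Subtype.val : J → ι)).comp L.subtype) (by simpa using hlt))
  have hyJ' : ∀ i, ‖x i‖ = 1 → y i = 0 := fun i hi => by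
    simpa using congrFun (LinearMap.mem_ker.1 hyJ) ⟨i, by simp [hJ, hi]⟩
  have hev : ∀ z : ι → ℂ, (∀ i, ‖x i‖ = 1 → z i = 0) →
      ∀ᶠ t : ℝ in 𝓝[>] 0, ∀ i, ‖(x + t • z) i‖ ≤ 1 := fun z hz => by
    refine eventually_all.2 fun i => ?_
    rcases (hx1 i).eq_or_lt with hi | hi
    · exact Eventually.of_forall fun t => by simp [hz i hi, hi]
    · have hc : Continuous fun t : ℝ => ‖(x + t • z) i‖ := by
        simp only [Pi.add_apply, Pi.smul_apply]; fun_prop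
      have h0 : ∀ᶠ t : ℝ in 𝓝 0, ‖(x + t • z) i‖ < 1 :=
        hc.continuousAt.eventually_lt continuousAt_const (by simpa using hi)
      exact (h0.filter_mono nhdsWithin_le_nhds).mono fun t ht => ht.le
  obtain ⟨t, ⟨ht₁, ht₂⟩, ht0⟩ := (((hev y hyJ').and
    (hev (-y) fun i hi => by simp [hyJ' i hi])).and self_mem_nhdsWithin).exists
  have hmemL : ∀ z ∈ L, x + t • z ∈ L := fun z hz => by
    rw [← Complex.coe_smul]; exact L.add_mem hxL (L.smul_mem _ hz)
  have hseg : x ∈ openSegment ℝ (x + t • y) (x + t • -y) :=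
    ⟨1 / 2, 1 / 2, by norm_num, by norm_num, by norm_num, by module⟩
  have hxy := hx.2 ⟨hmemL y hyL, (hmem _).2 ht₁⟩
    ⟨hmemL (-y) (L.neg_mem hyL), (hmem _).2 ht₂⟩ hseg
  have h0 : t • y = 0 := by simpa using hxy
  exact hy0 (Subtype.ext ((smul_eq_zero.1 h0).resolve_left (ne_of_gt ht0)))

/-- If all coordinates of `x` are at most `1` in modulus and at least `m ≥ 1` of them are
unimodular, then `‖x‖_{p₂} ≥ m ^ (1/p₂ - 1/p₁) ‖x‖_{p₁}`. -/
theorem rpow_mul_norm_toLp_le {ι : Type*} [Fintype ι] {p₁ p₂ : ℝ≥0∞} (hp₂ : 1 ≤ p₂)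
    (h : p₂ < p₁) {x : ι → ℂ} (hx : ∀ i, ‖x i‖ ≤ 1) {m : ℕ} (hm : 1 ≤ m)
    (hcard : m ≤ (Finset.univ.filter fun i => ‖x i‖ = 1).card) :
    (m : ℝ) ^ ((p₂⁻¹).toReal - (p₁⁻¹).toReal) * ‖WithLp.toLp p₁ x‖ ≤ ‖WithLp.toLp p₂ x‖ := by
  have hm0 : (0 : ℝ) < m := by exact_mod_cast hm
  have hp₂top : p₂ ≠ ∞ := h.ne_top
  have hq : 0 < p₂.toReal := ENNReal.toReal_pos (by positivity) hp₂top
  have hS : (m : ℝ) ≤ ∑ i, ‖x i‖ ^ p₂.toReal := calc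
    (m : ℝ) ≤ ((Finset.univ.filter fun i => ‖x i‖ = 1).card : ℝ) := by exact_mod_cast hcard
    _ = ∑ i ∈ Finset.univ.filter (fun i => ‖x i‖ = 1), ‖x i‖ ^ p₂.toReal := by
      rw [Finset.sum_congr rfl fun i hi => by rw [(Finset.mem_filter.1 hi).2, Real.one_rpow]]
      simp
    _ ≤ ∑ i, ‖x i‖ ^ p₂.toReal :=
      Finset.sum_le_sum_of_subset_of_nonneg (Finset.filter_subset _ _) fun _ _ _ => by positivity
  rw [PiLp.norm_eq_sum hq, ENNReal.toReal_inv, ENNReal.toReal_inv, one_div]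
  rcases eq_or_ne p₁ ∞ with rfl | hp₁
  · have hle : ‖WithLp.toLp ∞ x‖ ≤ 1 := by
      rw [PiLp.norm_eq_ciSup]; exact Real.iSup_le hx zero_le_one
    calc _ ≤ (m : ℝ) ^ p₂.toReal⁻¹ * 1 := by
          simpa using mul_le_mul_of_nonneg_left hle (by positivity)
      _ ≤ _ := by rw [mul_one]; exact Real.rpow_le_rpow hm0.le hS (by positivity)
  · have hqp : p₂.toReal < p₁.toReal := (ENNReal.toReal_lt_toReal hp₂top hp₁).2 h
    have hp : 0 < p₁.toReal := hq.trans hqp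
    rw [PiLp.norm_eq_sum hp, one_div]
    have hS₁ : ∑ i, ‖x i‖ ^ p₁.toReal ≤ ∑ i, ‖x i‖ ^ p₂.toReal :=
      Finset.sum_le_sum fun i _ => Real.rpow_le_rpow_of_exponent_ge_of_imp (norm_nonneg _) (hx i)
        hqp.le fun _ h0 => absurd h0 hp.ne'
    have hc : 0 ≤ p₂.toReal⁻¹ - p₁.toReal⁻¹ := sub_nonneg.2 (inv_anti₀ hq hqp.le)
    calc _ ≤ (∑ i, ‖x i‖ ^ p₂.toReal) ^ (p₂.toReal⁻¹ - p₁.toReal⁻¹) *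
          (∑ i, ‖x i‖ ^ p₂.toReal) ^ p₁.toReal⁻¹ := by
          gcongr
      _ = _ := by rw [← Real.rpow_add (hm0.trans_le hS), sub_add_cancel]

/-- If `y` agrees with `x` on `s` and vanishes off `s`, then
`‖y‖_{p₂} ≤ |s| ^ (1/p₂ - 1/p₁) ‖x‖_{p₁}`. -/
theorem norm_toLp_le_card_rpow_mul {ι : Type*} [Fintype ι] {p₁ p₂ : ℝ≥0∞} [Fact (1 ≤ p₁)]
    (hp₂ : 1 ≤ p₂) (h : p₂ < p₁) {x y : ι → ℂ} {s : Finset ι} (hs : ∀ i ∈ s, y i = x i)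
    (hs' : ∀ i ∉ s, y i = 0) :
    ‖WithLp.toLp p₂ y‖ ≤
      (s.card : ℝ) ^ ((p₂⁻¹).toReal - (p₁⁻¹).toReal) * ‖WithLp.toLp p₁ x‖ := by
  have hp₂top : p₂ ≠ ∞ := h.ne_top
  have hq : 0 < p₂.toReal := ENNReal.toReal_pos (by positivity) hp₂top
  have hsum : ∑ i, ‖y i‖ ^ p₂.toReal = ∑ i ∈ s, ‖x i‖ ^ p₂.toReal := by
    rw [← Finset.sum_subset s.subset_univ fun i _ hi => by
      rw [hs' i hi, norm_zero, Real.zero_rpow hq.ne']]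
    exact Finset.sum_congr rfl fun i hi => by rw [hs i hi]
  rw [PiLp.norm_eq_sum hq, ENNReal.toReal_inv, ENNReal.toReal_inv, one_div]
  change (∑ i, ‖y i‖ ^ p₂.toReal) ^ _ ≤ _
  rw [hsum]
  rcases eq_or_ne p₁ ∞ with rfl | hp₁
  · calc _ ≤ ((s.card : ℝ) * ‖WithLp.toLp ∞ x‖ ^ p₂.toReal) ^ p₂.toReal⁻¹ := by
          refine Real.rpow_le_rpow (by positivity) ?_ (by positivity)
          rw [← nsmul_eq_mul]
          exact Finset.sum_le_card_nsmul _ _ _ fun i _ => Real.rpow_le_rpow (norm_nonneg _)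
            (PiLp.norm_apply_le (WithLp.toLp ∞ x) i) hq.le
      _ = _ := by
          rw [Real.mul_rpow (by positivity) (by positivity),
            Real.rpow_rpow_inv (norm_nonneg _) hq.ne']
          simp
  · have hqp : p₂.toReal < p₁.toReal := (ENNReal.toReal_lt_toReal hp₂top hp₁).2 h
    have hp : 0 < p₁.toReal := hq.trans hqp
    rw [PiLp.norm_eq_sum hp, one_div]
    have key := Real.rpow_sum_le_const_mul_sum_rpow s (fun i => ‖x i‖ ^ p₂.toReal)
      ((one_le_div hq).2 hqp.le)
    simp only [abs_of_nonneg (Real.rpow_nonneg (norm_nonneg (x _)) _)] at key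
    simp only [← Real.rpow_mul (norm_nonneg (x _)), mul_div_cancel₀ _ hq.ne'] at key
    have key' : (∑ i ∈ s, ‖x i‖ ^ p₂.toReal) ^ (p₁.toReal / p₂.toReal) ≤
        (s.card : ℝ) ^ (p₁.toReal / p₂.toReal - 1) * ∑ i, ‖x i‖ ^ p₁.toReal :=
      key.trans <| mul_le_mul_of_nonneg_left (Finset.sum_le_sum_of_subset_of_nonneg
        s.subset_univ fun _ _ _ => by positivity) (by positivity)
    have key2 := Real.rpow_le_rpow (by positivity) key' (inv_nonneg.2 hp.le)
    rw [← Real.rpow_mul (by positivity), Real.mul_rpow (by positivity) (by positivity),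
      ← Real.rpow_mul (by positivity)] at key2
    convert key2 using 2
    · field_simp
    · congr 1; field_simp

/-- The coordinate projection onto the first `n` coordinates, as an operator
`ℓ_{p₁}^N → ℓ_{p₂}^N`. -/
noncomputable def lpTruncate (p₁ p₂ : ℝ≥0∞) [Fact (1 ≤ p₁)] [Fact (1 ≤ p₂)] (N n : ℕ) :
    PiLp p₁ (fun _ : Fin N => ℂ) →L[ℂ] PiLp p₂ (fun _ : Fin N => ℂ) :=
  LinearMap.toContinuousLinearMap
    (((WithLp.linearEquiv p₂ ℂ (Fin N → ℂ)).symm.toLinearMap.comp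
      (Function.ExtendByZero.linearMap ℂ (Subtype.val : {i : Fin N // (i : ℕ) < n} → Fin N))).comp
      ((LinearMap.funLeft ℂ ℂ Subtype.val).comp (WithLp.linearEquiv p₁ ℂ (Fin N → ℂ)).toLinearMap))

theorem lpTruncate_apply (p₁ p₂ : ℝ≥0∞) [Fact (1 ≤ p₁)] [Fact (1 ≤ p₂)] (N n : ℕ)
    (x : PiLp p₁ (fun _ : Fin N => ℂ)) (i : Fin N) :
    lpTruncate p₁ p₂ N n x i = if (i : ℕ) < n then x i else 0 := by
  change Function.extend (Subtype.val : {i : Fin N // (i : ℕ) < n} → Fin N)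
    (fun j => x j.val) 0 i = _
  split_ifs with hi
  · exact Subtype.val_injective.extend_apply _ _ (⟨i, hi⟩ : {i : Fin N // (i : ℕ) < n})
  · exact Function.extend_apply' _ _ _ fun ⟨j, hj⟩ => hi (hj ▸ j.2)

theorem rank_range_lpTruncate_le (p₁ p₂ : ℝ≥0∞) [Fact (1 ≤ p₁)] [Fact (1 ≤ p₂)] (N n : ℕ) :
    Module.rank ℂ (LinearMap.range (lpTruncate p₁ p₂ N n :
      PiLp p₁ (fun _ : Fin N => ℂ) →ₗ[ℂ] PiLp p₂ (fun _ : Fin N => ℂ))) ≤ (n : Cardinal) := by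
  have hcard : Fintype.card {i : Fin N // (i : ℕ) < n} ≤ n := by
    simpa using Fintype.card_le_of_injective
      (fun i : {i : Fin N // (i : ℕ) < n} => (⟨i.1, i.2⟩ : Fin n))
      fun i j hij => Subtype.ext (Fin.ext (by simpa using hij))
  refine (LinearMap.rank_comp_le_left _ _).trans ?_
  refine (LinearMap.rank_le_domain _).trans ?_
  rw [rank_fun']
  exact_mod_cast hcard

/-- If `1 ≤ p₂ < p₁ ≤ ∞` and `k ≤ N`, then
`a_k(id : ℓ_{p₁}^N → ℓ_{p₂}^N) = (N - k + 1)^{1/p₂ - 1/p₁}` (with `1/∞ = 0`). -/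
theorem stmt2 (p₁ p₂ : ℝ≥0∞) [Fact (1 ≤ p₁)] [Fact (1 ≤ p₂)] (h : p₂ < p₁)
    (N k : ℕ) (hk : 1 ≤ k) (hkN : k ≤ N) :
    approxNumber (lpId p₁ p₂ N) k
      = ((N : ℝ) - (k : ℝ) + 1) ^ ((p₂⁻¹).toReal - (p₁⁻¹).toReal) := by
  have hp₂ : 1 ≤ p₂ := Fact.out
  have hmcast : (N : ℝ) - (k : ℝ) + 1 = ((N - k + 1 : ℕ) : ℝ) := by
    push_cast [Nat.cast_sub hkN]; rfl
  rw [hmcast]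
  have hid : ∀ x : Fin N → ℂ, lpId p₁ p₂ N (WithLp.toLp p₁ x) = WithLp.toLp p₂ x := fun _ => rfl
  have lower : ∀ A : PiLp p₁ (fun _ : Fin N => ℂ) →L[ℂ] PiLp p₂ (fun _ : Fin N => ℂ),
      Module.rank ℂ (LinearMap.range A.toLinearMap) < (k : Cardinal) →
      ((N - k + 1 : ℕ) : ℝ) ^ ((p₂⁻¹).toReal - (p₁⁻¹).toReal) ≤ ‖lpId p₁ p₂ N - A‖ := by
    intro A hA
    let e := (WithLp.linearEquiv p₁ ℂ (Fin N → ℂ)).symm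
    let B := A.toLinearMap.comp e.toLinearMap
    have hrank : Module.finrank ℂ (LinearMap.range B) < k := by
      have hr : LinearMap.range B = LinearMap.range A.toLinearMap :=
        LinearMap.range_comp_of_range_eq_top _ (LinearEquiv.range e)
      rw [hr]
      exact Module.finrank_lt_of_rank_lt hA
    have hadd := B.finrank_range_add_finrank_ker
    rw [Module.finrank_fin_fun] at hadd
    obtain ⟨x, hxB, hx1, hxc⟩ := exists_mem_finrank_le_card_norm_eq_one (LinearMap.ker B)
    have hm : N - k + 1 ≤ (Finset.univ.filter fun i => ‖x i‖ = 1).card := by omega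
    have hle := rpow_mul_norm_toLp_le hp₂ h hx1 (Nat.le_add_left 1 _) hm
    have hAx : A (WithLp.toLp p₁ x) = 0 := hxB
    have hx0 : 0 < ‖WithLp.toLp p₁ x‖ := by
      obtain ⟨i, hi⟩ := Finset.card_pos.1 ((Nat.succ_pos _).trans_le hm)
      calc (0 : ℝ) < 1 := one_pos
        _ = ‖x i‖ := (Finset.mem_filter.1 hi).2.symm
        _ ≤ _ := PiLp.norm_apply_le (WithLp.toLp p₁ x) i
    refine le_of_mul_le_mul_right (hle.trans ?_) hx0
    simpa [hAx, hid] using (lpId p₁ p₂ N - A).le_opNorm (WithLp.toLp p₁ x)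
  have hrank : Module.rank ℂ (LinearMap.range (lpTruncate p₁ p₂ N (k - 1) :
      PiLp p₁ (fun _ : Fin N => ℂ) →ₗ[ℂ] PiLp p₂ (fun _ : Fin N => ℂ))) < (k : Cardinal) :=
    (rank_range_lpTruncate_le p₁ p₂ N (k - 1)).trans_lt (by exact_mod_cast Nat.sub_lt hk one_pos)
  have hcard : (Finset.univ.filter fun i : Fin N => ¬ (i : ℕ) < k - 1).card = N - k + 1 := by
    rw [Finset.filter_not, Finset.card_sdiff_of_subset (Finset.filter_subset _ _),
      Fin.card_filter_val_lt]
    simp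
    omega
  refine le_antisymm (csInf_le_of_le ⟨0, ?_⟩ ⟨_, hrank, rfl⟩ ?_)
    (le_csInf ⟨_, _, hrank, rfl⟩ ?_)
  · rintro _ ⟨A, -, rfl⟩
    exact norm_nonneg _
  · refine ContinuousLinearMap.opNorm_le_bound _ (by positivity) fun x => ?_
    rw [← hcard]
    refine norm_toLp_le_card_rpow_mul (y := ((lpId p₁ p₂ N - lpTruncate p₁ p₂ N (k - 1)) x).ofLp)
      hp₂ h (fun i hi => ?_) fun i hi => ?_
    · change x i - lpTruncate p₁ p₂ N (k - 1) x i = x i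
      rw [lpTruncate_apply, if_neg (Finset.mem_filter.1 hi).2, sub_zero]
    · change x i - lpTruncate p₁ p₂ N (k - 1) x i = 0
      rw [lpTruncate_apply, if_pos (by simp at hi; omega), sub_self]
  · rintro _ ⟨A, hA, rfl⟩
    exact lower A hA
end
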